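/- arXiv:math/0509668 — 2 statements merged into one kernel-verified Lean document; each statement's English description precedes it below -/
import Mathlib

section
/- Let 1 ≤ p < 2 and let V : ℝ → ℝ be measurable and locally integrable with ∫_ℝ |V(x)|^p dx < ∞. Then for Lebesgue-almost every k > 0, every solution u of the eigenfunction equation −u'' + V u = k²u (i.e., every differentiable u : ℝ → ℂ whose derivative satisfies u'(x) = u'(0) + ∫₀ˣ (V(y) − k²)·u(y) dy for all x) is bounded on ℝ: sup_{x ∈ ℝ} |u(x)| < ∞. -/
open Real Set MeasureTheory Filter

/-- `u : ℝ → ℂ` solves `-u'' + V u = E u` in the integral sense: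
`u` is differentiable and `u'(x) = u'(0) + ∫₀ˣ (V(y) - E) u(y) dy`. -/
def SchrodingerSolution (V : ℝ → ℝ) (E : ℝ) (u : ℝ → ℂ) : Prop :=
  Differentiable ℝ u ∧
    ∀ x : ℝ, deriv u x = deriv u 0 + ∫ y in (0:ℝ)..x, ((V y : ℂ) - (E : ℂ)) * u y

/-- domination criterion for absolute continuity -/
lemma ac_of_dist_le {f : ℝ → ℂ} {h : ℝ → ℝ} {a b : ℝ}
    (hh : AbsolutelyContinuousOnInterval h a b)
    (H : ∀ x y, dist (f x) (f y) ≤ dist (h x) (h y)) :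
    AbsolutelyContinuousOnInterval f a b := by
  unfold AbsolutelyContinuousOnInterval at hh ⊢
  refine squeeze_zero (fun t ↦ ?_) (fun t ↦ ?_) hh
  · exact Finset.sum_nonneg (fun i hi ↦ by positivity)
  · exact Finset.sum_le_sum (fun i hi ↦ H _ _)

lemma li_ii {E : Type*} [NormedAddCommGroup E] {f : ℝ → E} (hf : LocallyIntegrable f) (x y : ℝ) :
    IntervalIntegrable f volume x y :=
  intervalIntegrable_iff.mpr <|
      (hf.integrableOn_isCompact isCompact_uIcc).mono_set uIoc_subset_uIcc

lemma li_norm {f : ℝ → ℂ} (hf : LocallyIntegrable f) : LocallyIntegrable (fun x => ‖f x‖) :=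
  hf.mono hf.aestronglyMeasurable.norm (by simp)

lemma ac_integral {f : ℝ → ℂ} (hf : LocallyIntegrable f) (a b : ℝ) :
    AbsolutelyContinuousOnInterval (fun x => ∫ y in (0:ℝ)..x, f y) a b := by
  have hn : LocallyIntegrable (fun x => ‖f x‖) := li_norm hf
  have h1 : AbsolutelyContinuousOnInterval (fun x => ∫ y in a..x, ‖f y‖) a b :=
    (li_ii hn a b).absolutelyContinuousOnInterval_intervalIntegral (by simp)
  refine ac_of_dist_le h1 fun x y => ?_
  rw [dist_eq_norm, dist_eq_norm, intervalIntegral.integral_interval_sub_left (li_ii hf _ _) (li_ii hf _ _),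
    intervalIntegral.integral_interval_sub_left (li_ii hn _ _) (li_ii hn _ _)]
  exact intervalIntegral.norm_integral_le_abs_integral_norm

/-- the first function is a primitive of the second, which is locally integrable -/
structure Prim (f f' : ℝ → ℂ) : Prop where
  li : LocallyIntegrable f'
  eq : ∀ x, f x = f 0 + ∫ y in (0:ℝ)..x, f' y

lemma Prim.ac {f f' : ℝ → ℂ} (h : Prim f f') (a b : ℝ) : AbsolutelyContinuousOnInterval f a b := by
  refine ac_of_dist_le (h := fun x => ∫ y in a..x, ‖f' y‖) ?_ ?_
  · exact (li_ii (li_norm h.li) a b).absolutelyContinuousOnInterval_intervalIntegral (by simp)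
  · intro x y
    have hf := h.li
    have hn := (li_norm h.li)
    rw [dist_eq_norm, dist_eq_norm, h.eq x, h.eq y, add_sub_add_left_eq_sub, intervalIntegral.integral_interval_sub_left (li_ii hf _ _) (li_ii hf _ _),
      intervalIntegral.integral_interval_sub_left (li_ii hn _ _) (li_ii hn _ _)]
    exact intervalIntegral.norm_integral_le_abs_integral_norm

lemma Prim.cont {f f' : ℝ → ℂ} (h : Prim f f') : Continuous f := by
  have : f = fun x => f 0 + ∫ y in (0:ℝ)..x, f' y := funext h.eq
  rw [this]
  exact continuous_const.add (intervalIntegral.continuous_primitive (fun a b => li_ii h.li a b) 0)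

lemma Prim.deriv {f f' : ℝ → ℂ} (h : Prim f f') : ∀ᵐ x, HasDerivAt f (f' x) x := by
  filter_upwards [_root_.LocallyIntegrable.ae_hasDerivAt_integral h.li] with x hx
  have : f = fun x => f 0 + ∫ y in (0:ℝ)..x, f' y := funext h.eq
  rw [this]
  exact (hx 0).const_add _

lemma Prim.sub_eq {f f' : ℝ → ℂ} (h : Prim f f') (s t : ℝ) : f t - f s = ∫ y in s..t, f' y := by
  rw [h.eq t, h.eq s, add_sub_add_left_eq_sub, intervalIntegral.integral_interval_sub_left (li_ii h.li _ _) (li_ii h.li _ _)]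

lemma Prim.of_ac {f f' : ℝ → ℂ} (hac : ∀ a b, AbsolutelyContinuousOnInterval f a b)
    (hd : ∀ᵐ x, HasDerivAt f (f' x) x) (hli : LocallyIntegrable f') : Prim f f' := by
  refine ⟨hli, fun x => ?_⟩
  have h2 : AbsolutelyContinuousOnInterval (fun x => f x - ∫ y in (0:ℝ)..x, f' y) 0 x :=
    (hac 0 x).fun_sub (ac_integral hli 0 x)
  obtain ⟨C, hC⟩ := h2.const_of_ae_hasDerivAt_zero (by
    filter_upwards [hd, _root_.LocallyIntegrable.ae_hasDerivAt_integral hli] with y hy hy2 _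
    simpa using hy.fun_sub (hy2 0))
  have e1 := hC 0 (by simp)
  have e2 := hC x (by simp)
  simp only [intervalIntegral.integral_same, sub_zero] at e1
  rw [e1, ← e2]; ring

lemma li_cont_mul {f g : ℝ → ℂ} (hf : LocallyIntegrable f) (hg : Continuous g) :
    LocallyIntegrable (fun x => f x * g x) := by
  have := hf.continuous_smul hg
  refine this.congr (Eventually.of_forall fun x => ?_)
  simp [mul_comm]

lemma Prim.mul {f f' g g' : ℝ → ℂ} (hf : Prim f f') (hg : Prim g g') :
    Prim (fun x => f x * g x) (fun x => f' x * g x + g' x * f x) := by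
  refine Prim.of_ac (fun a b => (hf.ac a b).fun_smul (hg.ac a b)) ?_ ?_
  · filter_upwards [hf.deriv, hg.deriv] with x h1 h2
    have h3 := h1.mul h2
    have e : f' x * g x + g' x * f x = f' x * g x + f x * g' x := by ring
    rw [e]
    exact h3
  · exact (li_cont_mul hf.li hg.cont).add (li_cont_mul hg.li hf.cont)

lemma Prim.expI {θ θ' : ℝ → ℝ} (hli : LocallyIntegrable θ')
    (hθ : ∀ x, θ x = θ 0 + ∫ y in (0:ℝ)..x, θ' y) :
    Prim (fun x => Complex.exp (Complex.I * θ x))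
      (fun x => (θ' x : ℂ) * (Complex.I * Complex.exp (Complex.I * θ x))) := by
  have hc : Continuous θ := by
    rw [funext hθ]
    exact continuous_const.add (intervalIntegral.continuous_primitive (fun a b => li_ii hli a b) 0)
  refine Prim.of_ac (fun a b => ?_) ?_ ?_
  · refine ac_of_dist_le (h := fun x => ∫ y in a..x, θ' y) ?_ ?_
    · exact (li_ii hli a b).absolutelyContinuousOnInterval_intervalIntegral (by simp)
    · intro x y
      have e : dist (∫ z in a..x, θ' z) (∫ z in a..y, θ' z) = |θ x - θ y| := by
        rw [hθ x, hθ y, add_sub_add_left_eq_sub, Real.dist_eq,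
          intervalIntegral.integral_interval_sub_left (li_ii hli _ _) (li_ii hli _ _),
          intervalIntegral.integral_interval_sub_left (li_ii hli _ _) (li_ii hli _ _)]
      simp only [e]
      rw [dist_eq_norm]
      have : Complex.exp (Complex.I * θ x) - Complex.exp (Complex.I * θ y)
        = Complex.exp (Complex.I * θ y) * (Complex.exp (Complex.I * ((θ x - θ y : ℝ) : ℂ)) - 1) := by
        rw [mul_sub, ← Complex.exp_add]; push_cast; ring_nf
      rw [this, norm_mul, mul_comm Complex.I, Complex.norm_exp_ofReal_mul_I, one_mul]
      exact Real.norm_exp_I_mul_ofReal_sub_one_le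
  · filter_upwards [_root_.LocallyIntegrable.ae_hasDerivAt_integral hli] with x hx
    have h1 : HasDerivAt θ (θ' x) x := by
      rw [funext hθ]; exact (hx 0).const_add _
    have h2 := ((h1.ofReal_comp.const_mul Complex.I)).cexp
    convert h2 using 1
    ring
  · refine li_cont_mul ?_ (by fun_prop)
    exact hli.mono (by
      have := hli.aestronglyMeasurable
      exact Complex.continuous_ofReal.comp_aestronglyMeasurable this) (by simp)


lemma Prim.lin {f f' g g' : ℝ → ℂ} (hf : Prim f f') (hg : Prim g g') (c : ℂ) :
    Prim (fun x => f x + c * g x) (fun x => f' x + c * g' x) := by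
  have h2 : LocallyIntegrable (fun x => c * g' x) := by
    have := li_cont_mul hg.li (continuous_const (y := c))
    simpa only [mul_comm] using this
  refine ⟨hf.li.add h2, fun x => ?_⟩
  rw [intervalIntegral.integral_add (li_ii hf.li _ _) (li_ii h2 _ _),
    intervalIntegral.integral_const_mul, hf.eq x, hg.eq x]
  ring

/-- the WKB phase -/
noncomputable def phs (V : ℝ → ℝ) (k x : ℝ) : ℝ := k * x - (∫ y in (0:ℝ)..x, V y) / (2 * k)

/-- the oscillating potential -/
noncomputable def ww (V : ℝ → ℝ) (k x : ℝ) : ℂ :=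
  (V x : ℂ) * Complex.exp (Complex.I * ((-2 * phs V k x : ℝ) : ℂ))

lemma ode (V : ℝ → ℝ) (hloc : LocallyIntegrable V) (k : ℝ) (hk : 0 < k) (u : ℝ → ℂ)
    (hu : SchrodingerSolution V (k ^ 2) u) :
    ∃ A B : ℝ → ℂ, Continuous A ∧ Continuous B ∧
      (∀ s t, A t - A s = ∫ x in s..t, (Complex.I / (2 * k)) * ww V k x * B x) ∧
      (∀ s t, B t - B s = ∫ x in s..t, (-(Complex.I / (2 * k))) * star (ww V k x) * A x) ∧
      ∀ x, ‖u x‖ ≤ (‖A x‖ + ‖B x‖) / (2 * k) := by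
  obtain ⟨hd, he⟩ := hu
  have hVc : LocallyIntegrable (fun x => (V x : ℂ)) :=
    hloc.mono (Complex.continuous_ofReal.comp_aestronglyMeasurable hloc.aestronglyMeasurable) (by simp)
  have hVk : LocallyIntegrable (fun x => ((V x : ℂ) - ((k ^ 2 : ℝ) : ℂ))) :=
    hVc.sub (continuous_const.locallyIntegrable)
  have P1 : Prim (deriv u) (fun y => ((V y : ℂ) - ((k ^ 2 : ℝ) : ℂ)) * u y) :=
    ⟨li_cont_mul hVk hd.continuous, he⟩
  have P0 : Prim u (deriv u) := by
    refine ⟨P1.cont.locallyIntegrable, fun x => ?_⟩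
    rw [intervalIntegral.integral_deriv_eq_sub (fun x _ => hd x) (P1.cont.intervalIntegrable _ _)]
    ring
  have Pz := P1.lin P0 (Complex.I * k)
  have Pv := P1.lin P0 (-(Complex.I * k))
  have hθli : LocallyIntegrable (fun x => k - V x / (2 * k)) := by
    refine (continuous_const.locallyIntegrable).sub ?_
    have := hloc.smul (1 / (2 * k))
    refine this.congr (Eventually.of_forall fun x => ?_)
    simp; field_simp
  have hθ : ∀ x, phs V k x = phs V k 0 + ∫ y in (0:ℝ)..x, (k - V y / (2 * k)) := by
    intro x
    have h3 : IntervalIntegrable (fun y => V y / (2 * k)) volume 0 x := (li_ii hloc 0 x).div_const _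
    rw [intervalIntegral.integral_sub (by simp) h3, intervalIntegral.integral_div]
    simp [phs]; ring
  have hθ' : ∀ x, (-phs V k x) = -phs V k 0 + ∫ y in (0:ℝ)..x, -(k - V y / (2 * k)) := by
    intro x
    rw [intervalIntegral.integral_neg, hθ x]; ring
  have Pe := Prim.expI hθli hθ
  have Pe' := Prim.expI (θ := fun x => - phs V k x) hθli.neg hθ'
  have PA := Pe'.mul Pz
  have PB := Pe.mul Pv
  have hk0 : (k : ℂ) ≠ 0 := by exact_mod_cast hk.ne'
  refine ⟨_, _, PA.cont, PB.cont, fun s t => ?_, fun s t => ?_, fun x => ?_⟩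
  · rw [PA.sub_eq]
    congr 1
    ext x
    have h1 : Complex.exp (Complex.I * ((-2 * phs V k x : ℝ) : ℂ)) =
      Complex.exp (Complex.I * ((-phs V k x : ℝ) : ℂ)) * Complex.exp (Complex.I * ((-phs V k x : ℝ) : ℂ)) := by
      rw [← Complex.exp_add]; push_cast; ring_nf
    have h2 : Complex.exp (Complex.I * ((-phs V k x : ℝ) : ℂ)) * Complex.exp (Complex.I * (phs V k x : ℂ)) = 1 := by
      rw [← Complex.exp_add]; push_cast; ring_nf; simp
    simp only [ww, h1]
    set e := Complex.exp (Complex.I * ((-phs V k x : ℝ) : ℂ))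
    set e' := Complex.exp (Complex.I * (phs V k x : ℂ))
    simp only [Pi.neg_apply]
    push_cast
    have : Complex.I / (2 * k) * (V x * (e * e)) * (e' * (deriv u x + -(Complex.I * k) * u x)) =
      Complex.I / (2 * k) * V x * e * (e * e') * (deriv u x + -(Complex.I * k) * u x) := by ring
    rw [this, h2]
    field_simp
    linear_combination (-2*k^3*u x + V x * k * u x + u x * k * V x) * e * Complex.I_sq
  · rw [PB.sub_eq]
    congr 1
    ext x
    have h1 : star (Complex.exp (Complex.I * ((-2 * phs V k x : ℝ) : ℂ))) =
      Complex.exp (Complex.I * (phs V k x : ℂ)) * Complex.exp (Complex.I * (phs V k x : ℂ)) := by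
      rw [← Complex.exp_add, ← starRingEnd_apply, ← Complex.exp_conj]
      simp only [map_mul, Complex.conj_I, Complex.conj_ofReal]
      push_cast; ring_nf
    have h2 : Complex.exp (Complex.I * ((-phs V k x : ℝ) : ℂ)) * Complex.exp (Complex.I * (phs V k x : ℂ)) = 1 := by
      rw [← Complex.exp_add]; push_cast; ring_nf; simp
    have h4 : star (V x : ℂ) = V x := Complex.conj_ofReal _
    simp only [ww, star_mul', h1, h4]
    set e := Complex.exp (Complex.I * ((-phs V k x : ℝ) : ℂ))
    set e' := Complex.exp (Complex.I * (phs V k x : ℂ))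
    push_cast
    have : -(Complex.I / (2 * k)) * (V x * (e' * e')) * (e * (deriv u x + (Complex.I * k) * u x)) =
      -(Complex.I / (2 * k)) * V x * e' * (e * e') * (deriv u x + (Complex.I * k) * u x) := by ring
    rw [this, h2]
    field_simp
    linear_combination (-2*k^3*u x + 2 * V x * k * u x) * e' * Complex.I_sq
  · have h1 : (2 * Complex.I * k) * u x = (deriv u x + (Complex.I * k) * u x) - (deriv u x + (-(Complex.I * k)) * u x) := by ring
    have h2 : ‖(2 * Complex.I * k) * u x‖ = 2 * k * ‖u x‖ := by
      simp [abs_of_pos hk]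
    rw [le_div_iff₀ (by positivity), mul_comm, ← h2, h1]
    refine (norm_sub_le _ _).trans (le_of_eq ?_)
    simp only [norm_mul, mul_comm Complex.I (Complex.ofReal _), Complex.norm_exp_ofReal_mul_I]
    simp


lemma sum_Ico_double (f : ℕ → ℝ) (b c : ℕ) (h : b ≤ c) :
    ∑ j ∈ Finset.Ico b c, (f (2 * j) + f (2 * j + 1)) = ∑ j ∈ Finset.Ico (2 * b) (2 * c), f j := by
  induction c, h using Nat.le_induction with
  | base => simp
  | succ c hc ih =>
    rw [Finset.sum_Ico_succ_top hc, ih, show 2 * (c + 1) = 2 * c + 1 + 1 by ring,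
      Finset.sum_Ico_succ_top (by lia), Finset.sum_Ico_succ_top (by lia)]
    ring

lemma tree_step (d d' x' : ℕ → ℝ) (e e' : ℝ) (b c c' : ℕ) (s S : ℝ)
    (hd : ∀ j, 0 ≤ d' j) (hS : 0 ≤ S) (he' : 0 ≤ e')
    (hbc : b ≤ c)
    (hrec : ∀ j, b ≤ j → j < c → d j ≤ d' (2 * j) + d' (2 * j + 1)
      + x' (2 * j + 1) * (d' (2 * j) + x' (2 * j) * S))
    (hcut : (c' = 2 * c ∧ e ≤ e') ∨ (c' = 2 * c + 1 ∧ e ≤ e' + d' (2 * c) + x' (2 * c) * S))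
    (hs0 : 0 ≤ s) (hs1 : s ≤ 1)
    (hs : ∑ j ∈ Finset.Ico (2 * b) c', x' j ^ 2 ≤ s ^ 2) :
    e + ∑ j ∈ Finset.Ico b c, d j ≤
      (1 + s) * (e' + ∑ j ∈ Finset.Ico (2 * b) c', d' j) + 2 * s * S := by
  have hc' : 2 * c ≤ c' := by lia
  have hxs : ∀ j, 2 * b ≤ j → j < c' → x' j ≤ s := by
    intro j h1 h2
    have : x' j ^ 2 ≤ s ^ 2 := le_trans
      (Finset.single_le_sum (f := fun j => x' j ^ 2) (fun i _ => sq_nonneg _) (Finset.mem_Ico.2 ⟨h1, h2⟩)) hs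
    exact le_of_sq_le_sq this hs0
  have h1 : ∑ j ∈ Finset.Ico b c, d j ≤ ∑ j ∈ Finset.Ico b c,
      ((1 + s) * (d' (2 * j) + d' (2 * j + 1)) + S / 2 * (x' (2 * j) ^ 2 + x' (2 * j + 1) ^ 2)) := by
    refine Finset.sum_le_sum fun j hj => ?_
    rw [Finset.mem_Ico] at hj
    have h2 := hrec j hj.1 hj.2
    have h3 := hxs (2 * j + 1) (by lia) (by lia)
    have h4 := mul_le_mul_of_nonneg_right h3 (hd (2 * j))
    have h5 := mul_nonneg hs0 (hd (2 * j + 1))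
    have h6 := mul_nonneg hS (sq_nonneg (x' (2 * j) - x' (2 * j + 1)))
    nlinarith
  rw [Finset.sum_add_distrib, ← Finset.mul_sum, ← Finset.mul_sum, sum_Ico_double d' b c hbc,
    sum_Ico_double (fun j => x' j ^ 2) b c hbc] at h1
  have hss : s ^ 2 ≤ s := by nlinarith
  have hse := mul_nonneg hs0 he'
  rcases hcut with ⟨rfl, h2⟩ | ⟨rfl, h2⟩
  · have := mul_le_mul_of_nonneg_left (hs.trans hss) hS
    nlinarith
  · have hy := hxs (2 * c) (by lia) (by lia)
    rw [Finset.sum_Ico_succ_top (by lia)] at hs ⊢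
    have h7 : ∑ j ∈ Finset.Ico (2 * b) (2 * c), x' j ^ 2 ≤ s := by
      nlinarith [sq_nonneg (x' (2 * c))]
    have h8 := mul_le_mul_of_nonneg_left h7 hS
    have h9 := mul_le_mul_of_nonneg_left hy hS
    have h10 := mul_nonneg hs0 (hd (2 * c))
    have h11 := mul_nonneg hS hs0
    nlinarith

lemma tree (d x : ℕ → ℕ → ℝ) (e : ℕ → ℝ) (b c : ℕ → ℕ) (s : ℕ → ℝ) (S : ℝ)
    (hd : ∀ n j, 0 ≤ d n j) (hS : 0 ≤ S) (he : ∀ n, 0 ≤ e n)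
    (hb : ∀ n, b (n + 1) = 2 * b n) (hbc : ∀ n, b n ≤ c n) (h0 : b 0 = c 0)
    (hrec : ∀ n j, b n ≤ j → j < c n → d n j ≤ d (n+1) (2 * j) + d (n+1) (2 * j + 1)
      + x (n+1) (2 * j + 1) * (d (n+1) (2 * j) + x (n+1) (2 * j) * S))
    (hcut : ∀ n, (c (n+1) = 2 * c n ∧ e n ≤ e (n+1)) ∨
      (c (n+1) = 2 * c n + 1 ∧ e n ≤ e (n+1) + d (n+1) (2 * c n) + x (n+1) (2 * c n) * S))
    (hs0 : ∀ n, 0 ≤ s n)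
    (hs : ∀ n, ∑ j ∈ Finset.Ico (b n) (c n), x n j ^ 2 ≤ s n ^ 2)
    (hsum : ∀ N, ∑ n ∈ Finset.range N, s (n + 1) ≤ 1 / 10)
    (hlim : Tendsto (fun n => e n + ∑ j ∈ Finset.Ico (b n) (c n), d n j) atTop (nhds 0)) :
    e 0 ≤ S / 2 := by
  have hs1 : ∀ n, s (n + 1) ≤ 1 := fun n => by
    have h1 := hsum (n + 1)
    rw [Finset.sum_range_succ] at h1
    have h2 : 0 ≤ ∑ n ∈ Finset.range n, s (n + 1) := Finset.sum_nonneg fun i _ => hs0 _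
    linarith
  have key : ∀ N, e 0 ≤ Real.exp (∑ n ∈ Finset.range N, s (n + 1)) *
      (e N + ∑ j ∈ Finset.Ico (b N) (c N), d N j + 2 * S * ∑ n ∈ Finset.range N, s (n + 1)) := by
    intro N
    induction N with
    | zero => simp [h0]
    | succ N ih =>
      refine ih.trans ?_
      have st := tree_step (d N) (d (N+1)) (x (N+1)) (e N) (e (N+1)) (b N) (c N) (c (N+1))
        (s (N+1)) S (hd _) hS (he _) (hbc N) (hrec N) (hcut N) (hs0 _) (hs1 _)
        (by rw [← hb]; exact hs _)
      rw [← hb] at st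
      rw [Finset.sum_range_succ, Real.exp_add, mul_assoc (Real.exp _)]
      refine mul_le_mul_of_nonneg_left ?_ (Real.exp_pos _).le
      set D' := e (N+1) + ∑ j ∈ Finset.Ico (b (N+1)) (c (N+1)), d (N+1) j
      have hD' : 0 ≤ D' := add_nonneg (he _) (Finset.sum_nonneg fun i _ => hd _ _)
      set σ := ∑ n ∈ Finset.range N, s (n + 1)
      have hσ : 0 ≤ σ := Finset.sum_nonneg fun i _ => hs0 _
      have h3 := Real.add_one_le_exp (s (N+1))
      have hsN := hs0 (N+1)
      calc _ ≤ (1 + s (N+1)) * D' + 2 * s (N+1) * S + 2 * S * σ := by linarith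
        _ ≤ (1 + s (N+1)) * (D' + 2 * S * (σ + s (N+1))) := by
          have h4 : 0 ≤ s (N+1) * (2 * S * (σ + s (N+1))) := by positivity
          nlinarith
        _ ≤ _ := mul_le_mul_of_nonneg_right (by linarith) (by positivity)
  have hexp : Real.exp (1 / 10) ≤ 2 := by
    have := Real.exp_bound_div_one_sub_of_interval (x := 1/10) (by norm_num) (by norm_num)
    norm_num at this ⊢
    linarith
  have key2 : ∀ N, e 0 ≤ 2 * (e N + ∑ j ∈ Finset.Ico (b N) (c N), d N j + 2 * S * (1 / 10)) := by
    intro N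
    refine (key N).trans ?_
    have hσ : 0 ≤ ∑ n ∈ Finset.range N, s (n + 1) := Finset.sum_nonneg fun i _ => hs0 _
    have hD' : 0 ≤ e N + ∑ j ∈ Finset.Ico (b N) (c N), d N j :=
      add_nonneg (he _) (Finset.sum_nonneg fun i _ => hd _ _)
    have h5 := (Real.exp_le_exp.2 (hsum N)).trans hexp
    have h6 := mul_le_mul_of_nonneg_left (hsum N) hS
    refine mul_le_mul h5 (by linarith) ?_ (by norm_num)
    positivity
  have h7 : Tendsto (fun N => 2 * (e N + ∑ j ∈ Finset.Ico (b N) (c N), d N j + 2 * S * (1 / 10))) atTop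
      (nhds (2 * (0 + 2 * S * (1 / 10)))) := (hlim.add_const _).const_mul _
  have h8 := ge_of_tendsto' h7 key2
  linarith


lemma core_bound (w h : ℝ → ℂ) (hw : LocallyIntegrable w) (r q ρ S : ℝ)
    (hrq : r ≤ q) (hS : ∀ x ∈ Icc r q, ‖h x‖ ≤ S) (hρ : ∫ x in r..q, ‖w x‖ ≤ ρ) :
    ‖∫ x in r..q, w x * h x‖ ≤ ρ * S := by
  have hS0 : 0 ≤ S := (norm_nonneg _).trans (hS r ⟨le_rfl, hrq⟩)
  calc ‖∫ x in r..q, w x * h x‖ ≤ ∫ x in r..q, ‖w x‖ * S := by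
        refine intervalIntegral.norm_integral_le_of_norm_le hrq ?_ ((li_ii (li_norm hw) r q).mul_const S)
        refine Eventually.of_forall fun x hx => ?_
        rw [norm_mul]
        exact mul_le_mul_of_nonneg_left (hS x ⟨hx.1.le, hx.2⟩) (norm_nonneg _)
    _ = (∫ x in r..q, ‖w x‖) * S := by rw [intervalIntegral.integral_mul_const]
    _ ≤ _ := mul_le_mul_of_nonneg_right hρ hS0

lemma core_bound2 (w f g : ℝ → ℂ) (hw : LocallyIntegrable w) (hg : Continuous g) (r q ρ S : ℝ)
    (hrq : r ≤ q) (hf : f q - f r = ∫ x in r..q, w x * g x)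
    (hS : ∀ x ∈ Icc r q, ‖g x - g r‖ ≤ S) (hρ : ∫ x in r..q, ‖w x‖ ≤ ρ) :
    ‖f q - f r - (∫ x in r..q, w x) * g r‖ ≤ ρ * S := by
  rw [hf, ← intervalIntegral.integral_mul_const, ← intervalIntegral.integral_sub]
  · simp only [← mul_sub]
    exact core_bound w (fun x => g x - g r) hw r q ρ S hrq hS hρ
  · exact li_ii (li_cont_mul hw hg) _ _
  · exact (li_ii hw _ _).mul_const _

lemma star_ii (w : ℝ → ℂ) (r q : ℝ) : ∫ x in r..q, star (w x) = star (∫ x in r..q, w x) := by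
  simp only [intervalIntegral, star_sub]
  have := fun (s : Set ℝ) => integral_conj (f := w) (μ := volume.restrict s)
  simp only [starRingEnd_apply] at this
  rw [this, this]

lemma li_star {w : ℝ → ℂ} (hw : LocallyIntegrable w) : LocallyIntegrable (fun x => star (w x)) :=
  hw.mono (continuous_star.comp_aestronglyMeasurable hw.aestronglyMeasurable) (by simp)

lemma split_bound (a1 a2 a3 b1 b2 xJ xK yJ : ℂ) :
    ‖a3 - a1 - (xJ + xK) * b1‖ ≤ ‖a2 - a1 - xJ * b1‖ + ‖a3 - a2 - xK * b2‖
      + ‖xK‖ * (‖b2 - b1 - yJ * a1‖ + ‖yJ‖ * ‖a1‖) := by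
  have : a3 - a1 - (xJ + xK) * b1 = (a2 - a1 - xJ * b1) + (a3 - a2 - xK * b2)
      + xK * ((b2 - b1 - yJ * a1) + yJ * a1) := by ring
  rw [this]
  refine (norm_add₃_le).trans ?_
  rw [norm_mul, ← norm_mul yJ]
  gcongr
  exact norm_add_le _ _

lemma bounded_fixed (A B w : ℝ → ℂ) (hA : Continuous A) (hB : Continuous B)
    (hw : LocallyIntegrable w)
    (eA : ∀ s t, A t - A s = ∫ x in s..t, w x * B x)
    (eB : ∀ s t, B t - B s = ∫ x in s..t, star (w x) * A x)
    (F : ℝ → ℝ) (H : ℝ) (hH : 0 < H) (hF : StrictMonoOn F (Ici 0)) (hFH : ∀ t, 0 ≤ t → F t < H)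
    (pt : ℕ → ℕ → ℝ) (hp0 : ∀ n j, 0 ≤ pt n j)
    (hpF : ∀ n j, j < 2 ^ n → F (pt n j) = H * j / 2 ^ n)
    (hp2 : ∀ n j, pt (n + 1) (2 * j) = pt n j)
    (hwF : ∀ t, 0 ≤ t → ∃ C, 0 ≤ C ∧ ∀ r q, 0 ≤ r → r ≤ q → q ≤ t → ∫ x in r..q, ‖w x‖ ≤ C * (F q - F r))
    (s : ℕ → ℝ) (hs0 : ∀ n, 0 ≤ s n) (hsum : Summable s)
    (hs : ∀ n, ∑ j ∈ Finset.range (2 ^ n - 1), ‖∫ x in (pt n j)..(pt n (j + 1)), w x‖ ^ 2 ≤ s n ^ 2) :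
    ∃ C, ∀ t, 0 ≤ t → ‖A t‖ + ‖B t‖ ≤ C := by
  obtain ⟨n0, hn0⟩ : ∃ n0, ∀ N, ∑ n ∈ Finset.range N, s (n0 + (n + 1)) ≤ 1 / 10 := by
    have := tendsto_sum_nat_add s
    obtain ⟨n0, h⟩ := (this.eventually (gt_mem_nhds (show (0:ℝ) < 1 / 10 by norm_num))).exists
    refine ⟨n0, fun N => ?_⟩
    have hs2 : Summable (fun k => s (k + n0)) := (summable_nat_add_iff n0).2 hsum
    have h3 := hs2.sum_le_tsum (Finset.range (N + 1)) (fun i _ => hs0 _)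
    rw [Finset.sum_range_succ'] at h3
    have h4 : ∑ n ∈ Finset.range N, s (n0 + (n + 1)) = ∑ n ∈ Finset.range N, s (n + 1 + n0) :=
      Finset.sum_congr rfl fun i _ => by rw [add_comm]
    have := hs0 (0 + n0)
    linarith
  set x0 := pt n0 (2 ^ n0 - 1) with hx0
  have hx00 : 0 ≤ x0 := hp0 _ _
  have main : ∀ T S t, (∀ x ∈ Icc x0 T, ‖A x‖ + ‖B x‖ ≤ S) → t ∈ Icc x0 T →
      ‖A t - A x0‖ + ‖B t - B x0‖ ≤ S / 2 := by
    intro T S t hS ht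
    have ht0 : 0 ≤ t := hx00.trans ht.1
    have hS' : ∀ x, x0 ≤ x → x ≤ t → ‖A x‖ + ‖B x‖ ≤ S := fun x h1 h2 => hS x ⟨h1, h2.trans ht.2⟩
    have S0 : 0 ≤ S := le_trans (by positivity) (hS' t ht.1 le_rfl)
    obtain ⟨C1, hC1, hwC⟩ := hwF t ht0
    obtain ⟨β, hβ⟩ : ∃ β, β + 1 = 2 ^ n0 := ⟨2 ^ n0 - 1, Nat.sub_add_cancel Nat.one_le_two_pow⟩
    have hβ' : 2 ^ n0 - 1 = β := by lia
    rw [hβ'] at hx0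
    have hFx0 : F x0 = H * β / 2 ^ n0 := by rw [hx0]; exact hpF _ _ (by lia)
    have hFt : F x0 ≤ F t := hF.monotoneOn hx00 ht0 ht.1
    have hFt0 : 0 ≤ F t := le_trans (by rw [hFx0]; positivity) hFt
    have hFtH : F t < H := hFH t ht0
    set c : ℕ → ℕ := fun n => ⌊2 ^ (n0 + n) * F t / H⌋₊ with hc
    set b : ℕ → ℕ := fun n => 2 ^ n * β with hb
    have hP : ∀ n, (0:ℝ) < 2 ^ (n0 + n) := fun n => by positivity
    have hc1 : ∀ n, (c n : ℝ) ≤ 2 ^ (n0 + n) * F t / H := fun n => Nat.floor_le (by positivity)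
    have hc2 : ∀ n, 2 ^ (n0 + n) * F t / H < c n + 1 := fun n => Nat.lt_floor_add_one _
    have hclt : ∀ n, c n < 2 ^ (n0 + n) := by
      intro n
      have h1 : (c n : ℝ) < 2 ^ (n0 + n) := by
        refine (hc1 n).trans_lt ?_
        rw [div_lt_iff₀ hH]
        exact mul_lt_mul_of_pos_left hFtH (hP n)
      exact_mod_cast h1
    have hbr : ∀ n, (b n : ℝ) = 2 ^ (n0 + n) * F x0 / H := by
      intro n
      rw [hFx0, pow_add]; simp only [hb]; push_cast; field_simp
    have hbc : ∀ n, b n ≤ c n := by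
      intro n
      refine Nat.le_floor ?_
      rw [hbr]
      gcongr
    have hFp : ∀ n j, j ≤ c n → F (pt (n0 + n) j) = H * j / 2 ^ (n0 + n) :=
      fun n j hj => hpF _ _ (hj.trans_lt (hclt n))
    have le_of_F : ∀ x y, 0 ≤ x → 0 ≤ y → F x ≤ F y → x ≤ y := fun x y hx hy h =>
      (hF.le_iff_le hx hy).1 h
    have hpt : ∀ n j, j ≤ c n → pt (n0 + n) j ≤ t := by
      intro n j hj
      refine le_of_F _ _ (hp0 _ _) ht0 ?_
      rw [hFp n j hj]
      have h1 := hc1 n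
      have h2 : (j : ℝ) ≤ c n := by exact_mod_cast hj
      have h3 := h2.trans h1
      rw [le_div_iff₀ hH] at h3
      rw [div_le_iff₀ (hP n)]
      linarith
    have hx0p : ∀ n j, b n ≤ j → j ≤ c n → x0 ≤ pt (n0 + n) j := by
      intro n j hb' hj
      refine le_of_F _ _ hx00 (hp0 _ _) ?_
      rw [hFp n j hj]
      have h2 : (b n : ℝ) ≤ j := by exact_mod_cast hb'
      rw [hbr, div_le_iff₀ hH] at h2
      rw [le_div_iff₀ (hP n)]
      linarith
    have hpp : ∀ n j, j < c n → pt (n0 + n) j ≤ pt (n0 + n) (j + 1) := by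
      intro n j hj
      refine le_of_F _ _ (hp0 _ _) (hp0 _ _) ?_
      rw [hFp n j hj.le, hFp n (j + 1) hj]
      gcongr
      simp
    have hFd : ∀ n j, j < c n → F (pt (n0 + n) (j + 1)) - F (pt (n0 + n) j) = H / 2 ^ (n0 + n) := by
      intro n j hj
      rw [hFp n j hj.le, hFp n (j + 1) hj]
      push_cast; ring
    have osc : ∀ r q ρ, x0 ≤ r → r ≤ q → q ≤ t → C1 * (F q - F r) ≤ ρ →
        ‖A q - A r‖ ≤ ρ * S ∧ ‖B q - B r‖ ≤ ρ * S := by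
      intro r q ρ h1 h2 h3 h4
      have h5 := (hwC r q (hx00.trans h1) h2 h3).trans h4
      constructor
      · rw [eA]
        refine core_bound w B hw r q ρ S h2 (fun x hx => ?_) h5
        have := hS' x (h1.trans hx.1) (hx.2.trans h3)
        linarith [norm_nonneg (A x)]
      · rw [eB]
        refine core_bound (fun x => star (w x)) A (li_star hw) r q ρ S h2 (fun x hx => ?_) (by simpa using h5)
        have := hS' x (h1.trans hx.1) (hx.2.trans h3)
        linarith [norm_nonneg (B x)]
    have osc2 : ∀ r q ρ, x0 ≤ r → r ≤ q → q ≤ t → C1 * (F q - F r) ≤ ρ →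
        ‖A q - A r - (∫ x in r..q, w x) * B r‖ ≤ ρ * (ρ * S) ∧
        ‖B q - B r - star (∫ x in r..q, w x) * A r‖ ≤ ρ * (ρ * S) := by
      intro r q ρ h1 h2 h3 h4
      have h5 := (hwC r q (hx00.trans h1) h2 h3).trans h4
      have h6 : ∀ x ∈ Icc r q, C1 * (F x - F r) ≤ ρ := by
        intro x hx
        refine le_trans ?_ h4
        have : F x ≤ F q := hF.monotoneOn ((hx00.trans h1).trans hx.1) ((hx00.trans h1).trans h2) hx.2
        gcongr
      constructor
      · exact core_bound2 w A B hw hB r q ρ _ h2 (eA _ _)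
          (fun x hx => (osc r x ρ h1 hx.1 (hx.2.trans h3) (h6 x hx)).2) h5
      · rw [← star_ii]
        exact core_bound2 (fun x => star (w x)) B A (li_star hw) hA r q ρ _ h2 (eB _ _)
          (fun x hx => (osc r x ρ h1 hx.1 (hx.2.trans h3) (h6 x hx)).1) (by simpa using h5)
    set X : ℕ → ℕ → ℂ := fun n j => ∫ x in (pt (n0 + n) j)..(pt (n0 + n) (j + 1)), w x with hX
    set d : ℕ → ℕ → ℝ := fun n j =>
      ‖A (pt (n0 + n) (j + 1)) - A (pt (n0 + n) j) - X n j * B (pt (n0 + n) j)‖ +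
      ‖B (pt (n0 + n) (j + 1)) - B (pt (n0 + n) j) - star (X n j) * A (pt (n0 + n) j)‖ with hdd
    set e : ℕ → ℝ := fun n => ‖A t - A (pt (n0 + n) (c n))‖ + ‖B t - B (pt (n0 + n) (c n))‖ with hee
    have hp2' : ∀ n j, pt (n0 + (n + 1)) (2 * j) = pt (n0 + n) j := fun n j => hp2 (n0 + n) j
    have hc0 : b 0 = c 0 := by
      have h1 := hbc 0
      have h2 := hclt 0
      simp only [hb, pow_zero, one_mul, add_zero] at h1 h2 ⊢
      lia
    have hfin := tree d (fun n j => ‖X n j‖) e b c (fun n => s (n0 + n)) S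
      (fun n j => by positivity) S0 (fun n => by positivity)
      (fun n => by simp only [hb, pow_succ]; ring) hbc hc0 ?_ ?_ (fun n => hs0 _) ?_ hn0 ?_
    · have e0 : pt (n0 + 0) (c 0) = x0 := by
        rw [← hc0, hx0]; simp [hb]
      simpa only [hee, e0] using hfin
    · intro n j hj1 hj2
      have h1 := split_bound (A (pt (n0 + n) j)) (A (pt (n0 + (n + 1)) (2 * j + 1)))
        (A (pt (n0 + n) (j + 1))) (B (pt (n0 + n) j)) (B (pt (n0 + (n + 1)) (2 * j + 1)))
        (X (n + 1) (2 * j)) (X (n + 1) (2 * j + 1)) (star (X (n + 1) (2 * j)))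
      have h2 := split_bound (B (pt (n0 + n) j)) (B (pt (n0 + (n + 1)) (2 * j + 1)))
        (B (pt (n0 + n) (j + 1))) (A (pt (n0 + n) j)) (A (pt (n0 + (n + 1)) (2 * j + 1)))
        (star (X (n + 1) (2 * j))) (star (X (n + 1) (2 * j + 1))) (X (n + 1) (2 * j))
      have hXs : X (n + 1) (2 * j) + X (n + 1) (2 * j + 1) = X n j := by
        simp only [hX]
        rw [intervalIntegral.integral_add_adjacent_intervals (li_ii hw _ _) (li_ii hw _ _),
          show 2 * j + 1 + 1 = 2 * (j + 1) by ring, hp2', hp2']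
      rw [← star_add, hXs] at h2
      rw [hXs] at h1
      have h3 := hS' (pt (n0 + n) j) (hx0p n j hj1 hj2.le) (hpt n j hj2.le)
      have h4 := mul_le_mul_of_nonneg_left h3 (norm_nonneg (X (n + 1) (2 * j)))
      have h5 := mul_le_mul_of_nonneg_left h4 (norm_nonneg (X (n + 1) (2 * j + 1)))
      simp only [hdd, hp2', show 2 * j + 1 + 1 = 2 * (j + 1) by ring]
      simp only [norm_star] at h1 h2
      linarith
    · intro n
      have q1 : 2 * c n ≤ c (n + 1) := by
        refine Nat.le_floor ?_
        have := hc1 n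
        rw [← add_assoc, pow_succ]; push_cast
        calc 2 * (c n : ℝ) ≤ 2 * (2 ^ (n0 + n) * F t / H) := by linarith
          _ = _ := by ring
      have q2 : c (n + 1) < 2 * c n + 2 := by
        have h1 := hc1 (n + 1)
        have h2 := hc2 n
        rw [← add_assoc, pow_succ] at h1
        have h3 : (c (n + 1) : ℝ) < 2 * c n + 2 := by
          calc (c (n + 1) : ℝ) ≤ 2 ^ (n0 + n) * 2 * F t / H := h1
            _ = 2 * (2 ^ (n0 + n) * F t / H) := by ring
            _ < _ := by linarith
        exact_mod_cast h3
      rcases (show c (n + 1) = 2 * c n ∨ c (n + 1) = 2 * c n + 1 by lia) with h | h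
      · left
        refine ⟨h, ?_⟩
        simp only [hee, h, hp2']; exact le_rfl
      · right
        refine ⟨h, ?_⟩
        have h3 := hS' (pt (n0 + n) (c n)) (hx0p n _ (hbc n) le_rfl) (hpt n _ le_rfl)
        simp only [hee, hdd, h, hp2']
        set a := A (pt (n0 + n) (c n))
        set a' := A (pt (n0 + (n + 1)) (2 * c n + 1))
        set β' := B (pt (n0 + n) (c n))
        set β'' := B (pt (n0 + (n + 1)) (2 * c n + 1))
        set Y := X (n + 1) (2 * c n)
        have h4 : ‖A t - a‖ ≤ ‖A t - a'‖ + ‖a' - a - Y * β'‖ + ‖Y‖ * ‖β'‖ := by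
          rw [← norm_mul]
          refine le_trans (le_of_eq ?_) norm_add₃_le
          congr 1; ring
        have h5 : ‖B t - β'‖ ≤ ‖B t - β''‖ + ‖β'' - β' - star Y * a‖ + ‖Y‖ * ‖a‖ := by
          rw [← norm_star Y, ← norm_mul]
          refine le_trans (le_of_eq ?_) norm_add₃_le
          congr 1; ring
        have h6 := mul_le_mul_of_nonneg_left h3 (norm_nonneg Y)
        linarith
    · intro n
      refine le_trans (Finset.sum_le_sum_of_subset_of_nonneg ?_ fun _ _ _ => sq_nonneg _) (hs (n0 + n))
      intro j hj
      rw [Finset.mem_Ico] at hj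
      rw [Finset.mem_range]
      have := hclt n
      lia
    · have hbound : ∀ n, e n + ∑ j ∈ Finset.Ico (b n) (c n), d n j ≤
          (2 * (C1 * H) * S + 2 * (C1 * H) ^ 2 * S) * (1 / 2) ^ n := by
        intro n
        have hpw : H / 2 ^ (n0 + n) ≤ H * (1 / 2) ^ n := by
          rw [div_eq_mul_inv, one_div, inv_pow]
          gcongr
          · norm_num
          · lia
        have he1 : e n ≤ 2 * (C1 * H) * S * (1 / 2) ^ n := by
          have hF1 : F t - F (pt (n0 + n) (c n)) ≤ H / 2 ^ (n0 + n) := by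
            rw [hFp n _ le_rfl]
            have := hc2 n
            rw [div_lt_iff₀ hH] at this
            rw [sub_le_iff_le_add, ← add_div, le_div_iff₀ (hP n)]
            linarith
          have := osc (pt (n0 + n) (c n)) t (C1 * (H * (1 / 2) ^ n)) (hx0p n _ (hbc n) le_rfl) (hpt n _ le_rfl) le_rfl
            (mul_le_mul_of_nonneg_left (hF1.trans hpw) hC1)
          simp only [hee]
          linarith [this.1, this.2]
        have hd1 : ∀ j ∈ Finset.Ico (b n) (c n), d n j ≤ 2 * (C1 * H) ^ 2 * S * (1 / 2 ^ (n0 + n)) ^ 2 := by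
          intro j hj
          rw [Finset.mem_Ico] at hj
          have := osc2 (pt (n0 + n) j) (pt (n0 + n) (j + 1)) (C1 * (H / 2 ^ (n0 + n))) (hx0p n _ hj.1 hj.2.le)
            (hpp n j hj.2) (hpt n _ hj.2) (le_of_eq (by rw [hFd n j hj.2]))
          simp only [hdd]
          refine (add_le_add this.1 this.2).trans (le_of_eq ?_)
          ring
        have hd2 := Finset.sum_le_sum hd1
        rw [Finset.sum_const, nsmul_eq_mul, Nat.card_Ico] at hd2
        have hcard : ((c n - b n : ℕ) : ℝ) ≤ 2 ^ (n0 + n) := by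
          have : c n - b n ≤ 2 ^ (n0 + n) := (Nat.sub_le _ _).trans (hclt n).le
          exact_mod_cast this
        have hK : 0 ≤ 2 * (C1 * H) ^ 2 * S := by positivity
        have hd3 : ((c n - b n : ℕ) : ℝ) * (2 * (C1 * H) ^ 2 * S * (1 / 2 ^ (n0 + n)) ^ 2) ≤
            2 * (C1 * H) ^ 2 * S * (1 / 2) ^ n := by
          calc _ ≤ 2 ^ (n0 + n) * (2 * (C1 * H) ^ 2 * S * (1 / 2 ^ (n0 + n)) ^ 2) := by gcongr
            _ = 2 * (C1 * H) ^ 2 * S * (1 / 2 ^ (n0 + n)) := by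
              have := (hP n).ne'
              field_simp
            _ ≤ _ := by
              refine mul_le_mul_of_nonneg_left ?_ hK
              rw [one_div_pow]
              refine one_div_le_one_div_of_le (by positivity) ?_
              exact pow_le_pow_right₀ (by norm_num) (by lia)
        linarith
      refine squeeze_zero (fun n => ?_) hbound ?_
      · have : 0 ≤ ∑ j ∈ Finset.Ico (b n) (c n), d n j := Finset.sum_nonneg fun j _ => by positivity
        have : 0 ≤ e n := by positivity
        linarith
      · have := tendsto_pow_atTop_nhds_zero_of_lt_one (r := (1/2 : ℝ)) (by norm_num) (by norm_num)
        simpa using this.const_mul (2 * (C1 * H) * S + 2 * (C1 * H) ^ 2 * S)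
  have bd2 : ∀ T, x0 ≤ T → ‖A T‖ + ‖B T‖ ≤ 2 * (‖A x0‖ + ‖B x0‖) := by
    intro T hT
    obtain ⟨m, hm, hmax⟩ := isCompact_Icc.exists_isMaxOn (nonempty_Icc.2 hT)
      (f := fun x => ‖A x‖ + ‖B x‖) (by fun_prop)
    have h1 := main T (‖A m‖ + ‖B m‖) m (fun x hx => hmax hx) hm
    have h2 : ‖A m‖ ≤ ‖A m - A x0‖ + ‖A x0‖ := by simpa using norm_add_le (A m - A x0) (A x0)
    have h3 : ‖B m‖ ≤ ‖B m - B x0‖ + ‖B x0‖ := by simpa using norm_add_le (B m - B x0) (B x0)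
    have h4 : ‖A T‖ + ‖B T‖ ≤ ‖A m‖ + ‖B m‖ := hmax (show T ∈ Icc x0 T from ⟨hT, le_rfl⟩)
    linarith
  obtain ⟨m, hm, hmax⟩ := isCompact_Icc.exists_isMaxOn (nonempty_Icc.2 hx00)
      (f := fun x => ‖A x‖ + ‖B x‖) (by fun_prop)
  refine ⟨max (2 * (‖A x0‖ + ‖B x0‖)) (‖A m‖ + ‖B m‖), fun t ht => ?_⟩
  rcases le_total x0 t with h | h
  · exact (bd2 t h).trans (le_max_left _ _)
  · exact le_trans (hmax (show t ∈ Icc 0 x0 from ⟨ht, h⟩)) (le_max_right _ _)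


lemma vdc (α β D v : ℝ) (hα : 0 < α) (hαβ : α ≤ β) (hD : D ≠ 0) (hv : |v| ≤ α ^ 2 * |D|) :
    ‖∫ k in α..β, Complex.exp (Complex.I * ((-2 * (k * D - v / (2 * k)) : ℝ) : ℂ))‖ ≤ 2 * (β / α) / |D| := by
  have hD0 : 0 < |D| := abs_pos.2 hD
  have hkpos : ∀ k ∈ uIcc α β, α ≤ k := by
    intro k hk; rw [uIcc_of_le hαβ] at hk; exact hk.1
  have hψ : ∀ k, α ≤ k → |D| / 2 ≤ |D + v / (2 * k ^ 2)| := by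
    intro k hk
    have hk0 : 0 < k := hα.trans_le hk
    have h1 : |v / (2 * k ^ 2)| ≤ |D| / 2 := by
      rw [abs_div, abs_of_pos (by positivity : 0 < 2 * k ^ 2), div_le_iff₀ (by positivity)]
      have : α ^ 2 ≤ k ^ 2 := by gcongr
      nlinarith
    have h2 := abs_sub_abs_le_abs_sub D (-(v / (2 * k ^ 2)))
    rw [abs_neg, sub_neg_eq_add] at h2
    linarith
  have hψ0 : ∀ k, α ≤ k → D + v / (2 * k ^ 2) ≠ 0 := by
    intro k hk h
    have := hψ k hk
    rw [h, abs_zero] at this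
    linarith
  set E : ℝ → ℂ := fun k => Complex.exp (Complex.I * ((-2 * (k * D - v / (2 * k)) : ℝ) : ℂ)) with hE
  have hEn : ∀ k, ‖E k‖ = 1 := by
    intro k; simp only [hE]; rw [mul_comm, Complex.norm_exp_ofReal_mul_I]
  set q : ℝ → ℝ := fun k => (D + v / (2 * k ^ 2))⁻¹ with hq
  set q' : ℝ → ℝ := fun k => (v / k ^ 3) / (D + v / (2 * k ^ 2)) ^ 2 with hq'
  have hdphi : ∀ k, α ≤ k → HasDerivAt (fun k => -2 * (k * D - v / (2 * k))) (-2 * (D + v / (2 * k ^ 2))) k := by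
    intro k hk
    have hk0 : k ≠ 0 := (hα.trans_le hk).ne'
    have h1 : HasDerivAt (fun k : ℝ => v / (2 * k)) (-(v / (2 * k ^ 2))) k := by
      have := ((hasDerivAt_id k).const_mul 2).fun_inv (by simpa using hk0) |>.const_mul v
      simp only [id] at this
      simp only [div_eq_mul_inv v]
      refine this.congr_deriv ?_
      field_simp
    have h2 := (((hasDerivAt_id k).mul_const D).fun_sub h1).const_mul (-2)
    refine h2.congr_deriv ?_
    ring
  have hdE : ∀ k, α ≤ k → HasDerivAt E (E k * (Complex.I * ((-2 * (D + v / (2 * k ^ 2)) : ℝ) : ℂ))) k := by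
    intro k hk
    exact ((hdphi k hk).ofReal_comp.const_mul Complex.I).cexp
  have hdq : ∀ k, α ≤ k → HasDerivAt q (q' k) k := by
    intro k hk
    have hk0 : k ≠ 0 := (hα.trans_le hk).ne'
    have h1 : HasDerivAt (fun k : ℝ => v / (2 * k ^ 2)) (-(v / k ^ 3)) k := by
      have := (((hasDerivAt_id k).fun_pow 2).const_mul 2).fun_inv (by simpa using hk0) |>.const_mul v
      simp only [id] at this
      simp only [div_eq_mul_inv v]
      refine this.congr_deriv ?_
      field_simp
      norm_num
    have h2 := (h1.const_add D).fun_inv (hψ0 k hk)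
    refine h2.congr_deriv ?_
    simp [hq']
  have hdG : ∀ k ∈ uIcc α β, HasDerivAt (fun k => E k * (q k : ℂ)) (-2 * Complex.I * E k + E k * (q' k : ℂ)) k := by
    intro k hk
    have hk := hkpos k hk
    have h1 := (hdE k hk).fun_mul (hdq k hk).ofReal_comp
    refine h1.congr_deriv ?_
    have h3 : ((D + v / (2 * k ^ 2) : ℝ) : ℂ) * ((q k : ℝ) : ℂ) = 1 := by
      rw [← Complex.ofReal_mul]; simp only [hq]; rw [mul_inv_cancel₀ (hψ0 k hk)]; simp
    rw [Complex.ofReal_mul (-2)]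
    push_cast at h3 ⊢
    linear_combination (-2 * Complex.I * E k) * h3
  have hcE : ContinuousOn E (uIcc α β) := fun k hk => (hdE k (hkpos k hk)).continuousAt.continuousWithinAt
  have hcq' : ContinuousOn q' (uIcc α β) := by
    refine ContinuousOn.div ?_ ?_ ?_
    · refine continuousOn_const.div (by fun_prop) fun k hk => ?_
      have := hα.trans_le (hkpos k hk); positivity
    · refine ContinuousOn.pow (continuousOn_const.add (continuousOn_const.div (by fun_prop) fun k hk => ?_)) 2
      have := hα.trans_le (hkpos k hk); positivity
    · intro k hk
      exact pow_ne_zero _ (hψ0 k (hkpos k hk))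
  have hcq'c : ContinuousOn (fun k => (q' k : ℂ)) (uIcc α β) := Complex.continuous_ofReal.comp_continuousOn hcq'
  have i1 : IntervalIntegrable (fun k => -2 * Complex.I * E k) volume α β :=
    (continuousOn_const.mul hcE).intervalIntegrable
  have i2 : IntervalIntegrable (fun k => E k * (q' k : ℂ)) volume α β := (hcE.mul hcq'c).intervalIntegrable
  have ftc := intervalIntegral.integral_eq_sub_of_hasDerivAt hdG (i1.add i2)
  rw [intervalIntegral.integral_add i1 i2, intervalIntegral.integral_const_mul] at ftc
  have hqb : ∀ k, α ≤ k → ‖E k * (q k : ℂ)‖ ≤ 2 / |D| := by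
    intro k hk
    rw [norm_mul, hEn, one_mul, Complex.norm_real, Real.norm_eq_abs]
    simp only [hq]
    rw [abs_inv]
    exact (inv_anti₀ (by positivity) (hψ k hk)).trans_eq (inv_div _ _)
  have hq'b : ∀ k ∈ uIoc α β, ‖E k * (q' k : ℂ)‖ ≤ 4 / (α * |D|) := by
    intro k hk
    have hk := hkpos k (uIoc_subset_uIcc hk)
    have hk0 : 0 < k := hα.trans_le hk
    rw [norm_mul, hEn, one_mul, Complex.norm_real, Real.norm_eq_abs]
    simp only [hq']
    rw [abs_div, abs_div, abs_pow (D + _), abs_of_pos (by positivity : 0 < k ^ 3)]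
    have h1 : |v| / k ^ 3 ≤ |D| / α := by
      rw [div_le_div_iff₀ (by positivity) hα]
      have : α ^ 3 ≤ k ^ 3 := by gcongr
      nlinarith
    have h2 : (|D| / 2) ^ 2 ≤ |D + v / (2 * k ^ 2)| ^ 2 := by
      gcongr; exact hψ k hk
    calc |v| / k ^ 3 / |D + v / (2 * k ^ 2)| ^ 2 ≤ (|D| / α) / (|D| / 2) ^ 2 := by gcongr
      _ = _ := by field_simp; norm_num
  have hint := intervalIntegral.norm_integral_le_of_norm_le_const hq'b
  rw [abs_of_nonneg (show 0 ≤ β - α by linarith)] at hint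
  have h1 := hqb α le_rfl
  have h2 := hqb β hαβ
  have h3 : ‖-2 * Complex.I * ∫ k in α..β, E k‖ ≤ 2 / |D| + 2 / |D| + 4 / (α * |D|) * (β - α) := by
    have : -2 * Complex.I * (∫ k in α..β, E k) = (E β * (q β : ℂ) - E α * (q α : ℂ)) - ∫ k in α..β, E k * (q' k : ℂ) := by
      rw [← ftc]; ring
    rw [this]
    have h4 := norm_sub_le (E β * (q β : ℂ) - E α * (q α : ℂ)) (∫ k in α..β, E k * (q' k : ℂ))
    have h5 := norm_sub_le (E β * (q β : ℂ)) (E α * (q α : ℂ))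
    linarith
  have h6 : ‖-2 * Complex.I * ∫ k in α..β, E k‖ = 2 * ‖∫ k in α..β, E k‖ := by simp
  rw [h6] at h3
  have h7 : 2 / |D| + 2 / |D| + 4 / (α * |D|) * (β - α) = 2 * (2 * (β / α) / |D|) := by
    field_simp; ring
  linarith

lemma amgm (p F G K η : ℝ) (hp1 : 1 ≤ p) (hp2 : p < 2) (hF : 0 ≤ F) (hG : 0 ≤ G) (hK : 0 < K) (hK1 : K ≤ 1)
    (hη : 0 < η) :
    F * G * K ≤ η ^ (2 / p) * (F ^ p / η * (G ^ p / η) + F ^ p / η * K ^ (2 / p) + G ^ p / η * K ^ (2 / p)) := by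
  have hp : 0 < p := by linarith
  set P := F ^ p / η with hP
  set Q := G ^ p / η with hQ
  have hP0 : 0 ≤ P := by positivity
  have hQ0 : 0 ≤ Q := by positivity
  have eF : F = η ^ (1 / p) * P ^ (1 / p) := by
    rw [← Real.mul_rpow hη.le hP0, hP, mul_div_cancel₀ _ hη.ne', ← Real.rpow_mul hF]
    rw [mul_one_div_cancel hp.ne', Real.rpow_one]
  have eG : G = η ^ (1 / p) * Q ^ (1 / p) := by
    rw [← Real.mul_rpow hη.le hQ0, hQ, mul_div_cancel₀ _ hη.ne', ← Real.rpow_mul hG]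
    rw [mul_one_div_cancel hp.ne', Real.rpow_one]
  have hi1 : 1 / p ≤ 1 := by rw [div_le_one hp]; exact hp1
  have hi2 : 1 / 2 < 1 / p := one_div_lt_one_div_of_lt hp hp2
  set b := 1 - 1 / p with hb
  set a := 2 / p - 1 with ha
  have e2 : 2 / p = 2 * (1 / p) := by ring
  have hb0 : 0 ≤ b := by linarith
  have ha0 : 0 < a := by rw [ha, e2]; linarith
  have hab : a + b = 1 / p := by rw [ha, hb, e2]; ring
  have key := Real.geom_mean_le_arith_mean3_weighted ha0.le hb0 hb0 (mul_nonneg hP0 hQ0)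
    (mul_nonneg hP0 (Real.rpow_nonneg hK.le (2 / p))) (mul_nonneg hQ0 (Real.rpow_nonneg hK.le (2 / p)))
    (by rw [ha, hb, e2]; ring)
  have hKb : K ≤ (K ^ (2 / p)) ^ b * (K ^ (2 / p)) ^ b := by
    rw [← Real.rpow_mul hK.le, ← Real.rpow_add hK]
    nth_rewrite 1 [← Real.rpow_one K]
    refine Real.rpow_le_rpow_of_exponent_ge hK hK1 ?_
    rw [hb, e2]
    nlinarith [sq_nonneg (2 * (1 / p) - 1)]
  have hFG : F * G = η ^ (2 / p) * ((P * Q) ^ a * P ^ b * Q ^ b) := by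
    have hpos : (a + b) ≠ 0 := by rw [hab]; positivity
    rw [eF, eG, Real.mul_rpow hP0 hQ0, e2, two_mul, Real.rpow_add hη, ← hab,
      Real.rpow_add' hP0 hpos, Real.rpow_add' hQ0 hpos]
    ring
  have ha1 : a ≤ 1 := by rw [ha, e2]; linarith
  have hb1 : b ≤ 1 := by linarith
  have hPK : 0 ≤ P * K ^ (2 / p) := by positivity
  have hQK : 0 ≤ Q * K ^ (2 / p) := by positivity
  have hPQ : 0 ≤ P * Q := by positivity
  calc F * G * K = η ^ (2 / p) * ((P * Q) ^ a * P ^ b * Q ^ b * K) := by rw [hFG]; ring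
    _ ≤ η ^ (2 / p) * ((P * Q) ^ a * P ^ b * Q ^ b * ((K ^ (2 / p)) ^ b * (K ^ (2 / p)) ^ b)) := by gcongr
    _ = η ^ (2 / p) * ((P * Q) ^ a * (P * K ^ (2 / p)) ^ b * (Q * K ^ (2 / p)) ^ b) := by
      rw [Real.mul_rpow (x := P) (y := K ^ (2 / p)) hP0 (by positivity),
        Real.mul_rpow (x := Q) (y := K ^ (2 / p)) hQ0 (by positivity)]; ring
    _ ≤ η ^ (2 / p) * (a * (P * Q) + b * (P * K ^ (2 / p)) + b * (Q * K ^ (2 / p))) := by gcongr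
    _ ≤ _ := by
      refine mul_le_mul_of_nonneg_left ?_ (by positivity)
      linarith [mul_le_of_le_one_left hPQ ha1, mul_le_of_le_one_left hPK hb1, mul_le_of_le_one_left hQK hb1]

lemma abs_le_split (p δ a : ℝ) (hp1 : 1 ≤ p) (hδ : 0 < δ) : |a| ≤ δ + δ ^ (1 - p) * |a| ^ p := by
  have h0 : 0 ≤ δ ^ (1 - p) * |a| ^ p := by positivity
  rcases le_total |a| δ with h | h
  · linarith
  · have ha : 0 < |a| := hδ.trans_le h
    have h1 : |a| = |a| ^ (1 - p) * |a| ^ p := by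
      rw [← Real.rpow_add ha]; simp
    have h2 : |a| ^ (1 - p) ≤ δ ^ (1 - p) := Real.rpow_le_rpow_of_nonpos hδ h (by linarith)
    have h3 : |a| ^ (1 - p) * |a| ^ p ≤ δ ^ (1 - p) * |a| ^ p := by gcongr
    linarith

lemma int_split (p : ℝ) (hp1 : 1 ≤ p) (V : ℝ → ℝ) (hloc : LocallyIntegrable V)
    (hLp : Integrable (fun x => |V x| ^ p)) (δ : ℝ) (hδ : 0 < δ) (x y : ℝ) :
    |∫ z in y..x, V z| ≤ δ * |x - y| + δ ^ (1 - p) * ∫ z, |V z| ^ p := by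
  wlog h : y ≤ x generalizing x y
  · have := this y x (le_of_not_ge h)
    rwa [intervalIntegral.integral_symm, abs_neg, abs_sub_comm]
  have h1 : |∫ z in y..x, V z| ≤ ∫ z in y..x, |V z| := intervalIntegral.abs_integral_le_integral_abs h
  have i1 : IntervalIntegrable (fun z => δ + δ ^ (1 - p) * |V z| ^ p) volume y x :=
    intervalIntegrable_const.add (hLp.intervalIntegrable.const_mul _)
  have h2 : ∫ z in y..x, |V z| ≤ ∫ z in y..x, (δ + δ ^ (1 - p) * |V z| ^ p) :=
    intervalIntegral.integral_mono_on h (li_ii hloc y x).abs i1 fun z _ => abs_le_split p δ _ hp1 hδ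
  rw [intervalIntegral.integral_add intervalIntegrable_const (hLp.intervalIntegrable.const_mul _),
    intervalIntegral.integral_const_mul, intervalIntegral.integral_const, smul_eq_mul] at h2
  have h3 : ∫ z in y..x, |V z| ^ p ≤ ∫ z, |V z| ^ p := by
    rw [intervalIntegral.integral_of_le h]
    exact setIntegral_le_integral hLp (Eventually.of_forall fun z => by positivity)
  have h4 : δ ^ (1 - p) * ∫ z in y..x, |V z| ^ p ≤ δ ^ (1 - p) * ∫ z, |V z| ^ p := by gcongr
  rw [abs_of_nonneg (by linarith : 0 ≤ x - y)]
  linarith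

lemma kernel (p : ℝ) (hp1 : 1 ≤ p) (V : ℝ → ℝ) (hloc : LocallyIntegrable V)
    (hLp : Integrable (fun x => |V x| ^ p)) (α β : ℝ) (hα : 0 < α) (hαβ : α ≤ β) :
    ∃ C : ℝ, 0 ≤ C ∧ ∀ x y : ℝ, ‖∫ k in α..β, Complex.exp (Complex.I *
      ((-2 * (k * (x - y) - ((∫ z in (0:ℝ)..x, V z) - ∫ z in (0:ℝ)..y, V z) / (2 * k)) : ℝ) : ℂ))‖
        ≤ C * (1 / (1 + |x - y|)) := by
  set M := ∫ z, |V z| ^ p with hM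
  have hM0 : 0 ≤ M := integral_nonneg fun z => by positivity
  set δ := α ^ 2 / 2 with hδ
  have hδ0 : 0 < δ := by positivity
  set R := δ ^ (1 - p) * M with hR
  have hR0 : 0 ≤ R := by positivity
  set D0 := 1 + R / δ with hD0
  have hD1 : 1 ≤ D0 := by
    have : 0 ≤ R / δ := by positivity
    linarith
  have hβ : 0 < β := hα.trans_le hαβ
  have hba : 0 ≤ β - α := by linarith
  refine ⟨4 * (β / α) + (β - α) * (1 + D0), by positivity, fun x y => ?_⟩
  have hden : 0 < 1 + |x - y| := by positivity
  have hq : 0 ≤ β / α := by positivity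
  rw [mul_one_div, le_div_iff₀ hden]
  have triv : ‖∫ k in α..β, Complex.exp (Complex.I *
      ((-2 * (k * (x - y) - ((∫ z in (0:ℝ)..x, V z) - ∫ z in (0:ℝ)..y, V z) / (2 * k)) : ℝ) : ℂ))‖
        ≤ 1 * |β - α| := by
    refine intervalIntegral.norm_integral_le_of_norm_le_const fun k _ => ?_
    rw [mul_comm, Complex.norm_exp_ofReal_mul_I]
  rw [one_mul, abs_of_nonneg hba] at triv
  rcases le_total |x - y| D0 with h | h
  · have h1 : 1 + |x - y| ≤ 1 + D0 := by linarith
    have := mul_le_mul triv h1 hden.le hba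
    nlinarith
  · have hne : x - y ≠ 0 := by
      intro h0; rw [h0, abs_zero] at h; linarith
    have hpos : 0 < |x - y| := abs_pos.2 hne
    have e : (∫ z in (0:ℝ)..x, V z) - ∫ z in (0:ℝ)..y, V z = ∫ z in y..x, V z :=
      intervalIntegral.integral_interval_sub_left (li_ii hloc _ _) (li_ii hloc _ _)
    have hv : |(∫ z in (0:ℝ)..x, V z) - ∫ z in (0:ℝ)..y, V z| ≤ α ^ 2 * |x - y| := by
      rw [e]
      have h1 := int_split p hp1 V hloc hLp δ hδ0 x y
      have h2 : R ≤ δ * |x - y| := by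
        have : R / δ ≤ |x - y| := by linarith
        rw [div_le_iff₀ hδ0] at this
        linarith
      have h3 : α ^ 2 = δ + δ := by rw [hδ]; ring
      rw [h3]
      linarith
    have key := vdc α β (x - y) _ hα hαβ hne hv
    have h5 : 2 * (β / α) / |x - y| * (1 + |x - y|) ≤ 4 * (β / α) := by
      rw [div_mul_eq_mul_div, div_le_iff₀ hpos]
      nlinarith
    have h6 := mul_le_mul_of_nonneg_right key hden.le
    have h7 : 0 ≤ (β - α) * (1 + D0) := by positivity
    linarith

lemma prod_bound (p : ℝ) (hp1 : 1 ≤ p) (hp2 : p < 2) (W : ℝ → ℝ) (hW : Measurable W) (hW0 : ∀ x, 0 ≤ W x)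
    (S : Set ℝ) (hS : volume S < ⊤) (hWi : IntegrableOn W S) (hLp : IntegrableOn (fun x => W x ^ p) S)
    (η : ℝ) (hη : 0 < η) (hle : ∫ x in S, W x ^ p ≤ η) :
    ∫ z : ℝ × ℝ, W z.1 * W z.2 * (1 / (1 + |z.1 - z.2|)) ∂((volume.restrict S).prod (volume.restrict S))
      ≤ η ^ (2 / p) * (1 + 2 * ∫ x : ℝ, (1 + ‖x‖) ^ (-(2 / p))) := by
  have hp : 0 < p := by linarith
  set μ : Measure ℝ := volume.restrict S with hμ
  have : IsFiniteMeasure μ := ⟨by rw [hμ, Measure.restrict_apply_univ]; exact hS⟩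
  set P : ℝ → ℝ := fun x => W x ^ p / η with hP
  have hP0 : ∀ x, 0 ≤ P x := fun x => div_nonneg (Real.rpow_nonneg (hW0 x) _) hη.le
  have hPi : Integrable P μ := Integrable.div_const hLp η
  have hP1 : ∫ x, P x ∂μ ≤ 1 := by
    rw [hP, integral_div, div_le_one hη]; exact hle
  have hPn : 0 ≤ ∫ x, P x ∂μ := integral_nonneg hP0
  set G : ℝ → ℝ := fun x => (1 + ‖x‖) ^ (-(2 / p)) with hG
  have hG0 : ∀ x, 0 ≤ G x := fun x => Real.rpow_nonneg (by positivity) _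
  have hG1 : ∀ x, G x ≤ 1 := fun x =>
    Real.rpow_le_one_of_one_le_of_nonpos (by linarith [norm_nonneg x]) (by
      have : 0 ≤ 2 / p := by positivity
      linarith)
  have hGi : Integrable G := by
    refine integrable_one_add_norm ?_
    simp only [Module.finrank_self, Nat.cast_one]
    rw [lt_div_iff₀ hp]; linarith
  have hGm : Measurable G := by
    have : Continuous G := by
      refine Continuous.rpow_const (by fun_prop) fun x => Or.inl ?_
      have := norm_nonneg x
      positivity
    exact this.measurable
  have hK : ∀ z : ℝ × ℝ, (1 / (1 + |z.1 - z.2|)) ^ (2 / p) = G (z.1 - z.2) := by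
    intro z
    simp only [hG, Real.norm_eq_abs]
    rw [Real.rpow_neg (by positivity), one_div, Real.inv_rpow (by positivity)]
  have i1 : Integrable (fun z : ℝ × ℝ => P z.1 * P z.2) (μ.prod μ) := hPi.mul_prod hPi
  have hPm : Measurable P := by
    exact (hW.pow_const p).div_const η
  have i2 : Integrable (fun z : ℝ × ℝ => P z.1 * G (z.1 - z.2)) (μ.prod μ) := by
    refine (hPi.mul_prod (integrable_const (1:ℝ))).mono' ?_ (Eventually.of_forall fun z => ?_)
    · exact Measurable.aestronglyMeasurable (by fun_prop)
    · rw [Real.norm_eq_abs, abs_of_nonneg (mul_nonneg (hP0 _) (hG0 _))]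
      exact mul_le_mul_of_nonneg_left (hG1 _) (hP0 _)
  have i3 : Integrable (fun z : ℝ × ℝ => P z.2 * G (z.1 - z.2)) (μ.prod μ) := by
    refine (((integrable_const (1:ℝ)).mul_prod hPi)).mono' ?_ (Eventually.of_forall fun z => ?_)
    · exact Measurable.aestronglyMeasurable (by fun_prop)
    · rw [Real.norm_eq_abs, abs_of_nonneg (mul_nonneg (hP0 _) (hG0 _)), mul_comm]
      exact mul_le_mul_of_nonneg_right (hG1 _) (hP0 _)
  set g := ∫ x, G x with hg
  have hg0 : 0 ≤ g := integral_nonneg hG0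
  have b1 : ∫ z, P z.1 * P z.2 ∂(μ.prod μ) ≤ 1 := by
    rw [integral_prod_mul]
    exact mul_le_one₀ hP1 hPn hP1
  have b2 : ∫ z, P z.1 * G (z.1 - z.2) ∂(μ.prod μ) ≤ g := by
    rw [integral_prod _ i2]
    calc ∫ x, ∫ y, P x * G (x - y) ∂μ ∂μ ≤ ∫ x, P x * g ∂μ := by
          refine integral_mono i2.integral_prod_left (hPi.mul_const g) fun x => ?_
          simp only
          rw [integral_const_mul]
          refine mul_le_mul_of_nonneg_left ?_ (hP0 x)
          rw [hg, ← integral_sub_left_eq_self G volume x]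
          exact setIntegral_le_integral (hGi.comp_sub_left x) (Eventually.of_forall fun y => hG0 _)
      _ ≤ g := by
          rw [integral_mul_const]; exact mul_le_of_le_one_left hg0 hP1
  have b3 : ∫ z, P z.2 * G (z.1 - z.2) ∂(μ.prod μ) ≤ g := by
    rw [integral_prod_symm _ i3]
    calc ∫ y, ∫ x, P y * G (x - y) ∂μ ∂μ ≤ ∫ x, P x * g ∂μ := by
          refine integral_mono i3.integral_prod_right (hPi.mul_const g) fun x => ?_
          simp only
          rw [integral_const_mul]
          refine mul_le_mul_of_nonneg_left ?_ (hP0 x)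
          rw [hg, ← integral_sub_right_eq_self G x]
          exact setIntegral_le_integral (hGi.comp_sub_right x) (Eventually.of_forall fun y => hG0 _)
      _ ≤ g := by
          rw [integral_mul_const]; exact mul_le_of_le_one_left hg0 hP1
  have hK1 : ∀ z : ℝ × ℝ, 1 / (1 + |z.1 - z.2|) ≤ 1 := by
    intro z
    rw [div_le_one (by positivity)]
    linarith [abs_nonneg (z.1 - z.2)]
  calc ∫ z : ℝ × ℝ, W z.1 * W z.2 * (1 / (1 + |z.1 - z.2|)) ∂(μ.prod μ)
      ≤ ∫ z : ℝ × ℝ, η ^ (2 / p) * (P z.1 * P z.2 + P z.1 * G (z.1 - z.2) + P z.2 * G (z.1 - z.2)) ∂(μ.prod μ) := by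
        refine integral_mono_of_nonneg (Eventually.of_forall fun z => ?_)
          (((i1.add i2).add i3).const_mul _) (Eventually.of_forall fun z => ?_)
        · have := hW0 z.1
          have := hW0 z.2
          simp only [Pi.zero_apply]; positivity
        · have := amgm p (W z.1) (W z.2) (1 / (1 + |z.1 - z.2|)) η hp1 hp2 (hW0 _) (hW0 _) (by positivity) (hK1 z) hη
          rw [hK] at this
          exact this
    _ = η ^ (2 / p) * (∫ z, P z.1 * P z.2 ∂(μ.prod μ) + ∫ z, P z.1 * G (z.1 - z.2) ∂(μ.prod μ)
          + ∫ z, P z.2 * G (z.1 - z.2) ∂(μ.prod μ)) := by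
        have i12 : Integrable (fun z : ℝ × ℝ => P z.1 * P z.2 + P z.1 * G (z.1 - z.2)) (μ.prod μ) := i1.add i2
        rw [integral_const_mul, integral_add i12 i3, integral_add i1 i2]
    _ ≤ _ := by
        refine mul_le_mul_of_nonneg_left ?_ (by positivity)
        linarith

lemma ww_norm (V : ℝ → ℝ) (k x : ℝ) : ‖ww V k x‖ = |V x| := by
  unfold ww
  rw [norm_mul, mul_comm Complex.I, Complex.norm_exp_ofReal_mul_I, mul_one, Complex.norm_real, Real.norm_eq_abs]

lemma L2 (p : ℝ) (hp1 : 1 ≤ p) (hp2 : p < 2) (V : ℝ → ℝ) (hmeas : Measurable V) (hloc : LocallyIntegrable V)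
    (hLp : Integrable (fun x => |V x| ^ p)) (α β : ℝ) (hα : 0 < α) (hαβ : α ≤ β) :
    ∃ C : ℝ, 0 ≤ C ∧ ∀ s t η : ℝ, s ≤ t → 0 < η → ∫ x in s..t, |V x| ^ p ≤ η →
      ∫⁻ k in Icc α β, ENNReal.ofReal (‖∫ x in s..t, ww V k x‖ ^ 2) ≤ ENNReal.ofReal (C * η ^ (2 / p)) := by
  obtain ⟨C, hC0, hC⟩ := kernel p hp1 V hloc hLp α β hα hαβ
  set g := ∫ x : ℝ, (1 + ‖x‖) ^ (-(2 / p)) with hg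
  have hg0 : 0 ≤ g := integral_nonneg fun x => Real.rpow_nonneg (by positivity) _
  refine ⟨C * (1 + 2 * g), by positivity, fun s t η hst hη hle => ?_⟩
  rw [intervalIntegral.integral_of_le hst] at hle
  have hVS : IntegrableOn V (Ioc s t) := (li_ii hloc s t).1
  have pb := prod_bound p hp1 hp2 (fun x => |V x|) hmeas.abs (fun x => abs_nonneg _) (Ioc s t)
    (by simp) hVS.abs hLp.integrableOn η hη hle
  set μ : Measure ℝ := volume.restrict (Ioc s t) with hμ
  have : IsFiniteMeasure μ := ⟨by rw [hμ, Measure.restrict_apply_univ]; simp⟩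
  set ν : Measure ℝ := volume.restrict (Icc α β) with hν
  have : IsFiniteMeasure ν := ⟨by rw [hν, Measure.restrict_apply_univ]; simp⟩
  set Φ : ℝ → ℝ := fun x => ∫ z in (0:ℝ)..x, V z with hΦ
  have hΦc : Continuous Φ := intervalIntegral.continuous_primitive (fun a b => li_ii hloc a b) 0
  have hΦm : Measurable Φ := hΦc.measurable
  set E : ℝ → ℝ × ℝ → ℂ := fun k z => Complex.exp (Complex.I *
      ((-2 * (k * (z.1 - z.2) - (Φ z.1 - Φ z.2) / (2 * k)) : ℝ) : ℂ)) with hE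
  have hEn : ∀ k z, ‖E k z‖ = 1 := by
    intro k z; simp only [hE]; rw [mul_comm, Complex.norm_exp_ofReal_mul_I]
  set f : ℝ → ℝ × ℝ → ℂ := fun k z => ((V z.1 : ℂ) * (V z.2 : ℂ)) * E k z with hf
  have hww : ∀ k (z : ℝ × ℝ), ww V k z.1 * star (ww V k z.2) = f k z := by
    intro k z
    simp only [ww, phs, hf, hE, hΦ]
    rw [star_mul', Complex.star_def, Complex.conj_ofReal, ← Complex.exp_conj, map_mul, Complex.conj_I, Complex.conj_ofReal]
    rw [mul_mul_mul_comm, ← Complex.exp_add]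
    congr 2
    push_cast
    ring
  have hfm : Measurable (Function.uncurry f) := by
    simp only [Function.uncurry_def, hf, hE]
    fun_prop
  have hVV : Integrable (fun z : ℝ × ℝ => |V z.1| * |V z.2|) (μ.prod μ) := Integrable.mul_prod hVS.abs hVS.abs
  have hfn : ∀ k z, ‖f k z‖ = |V z.1| * |V z.2| := by
    intro k z
    simp only [hf]
    rw [norm_mul, hEn, mul_one, norm_mul, Complex.norm_real, Complex.norm_real, Real.norm_eq_abs, Real.norm_eq_abs]
  have hfi : Integrable (Function.uncurry f) (ν.prod (μ.prod μ)) := by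
    refine (((integrable_const (1:ℝ)).mul_prod hVV)).mono' hfm.aestronglyMeasurable
      (Eventually.of_forall fun z => ?_)
    simp only [Function.uncurry_def]
    rw [hfn, one_mul]
  have hsq : ∀ k, ((‖∫ x in s..t, ww V k x‖ ^ 2 : ℝ) : ℂ) = ∫ z, f k z ∂(μ.prod μ) := by
    intro k
    simp_rw [← hww]
    rw [integral_prod_mul (fun x => ww V k x) (fun x => star (ww V k x))]
    rw [intervalIntegral.integral_of_le hst]
    have : ∫ x, star (ww V k x) ∂μ = star (∫ x, ww V k x ∂μ) := by
      simpa [Complex.star_def] using (integral_conj (f := fun x => ww V k x) (μ := μ))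
    rw [this, Complex.star_def, Complex.mul_conj, Complex.normSq_eq_norm_sq]
  have hZi : Integrable (fun k => ((‖∫ x in s..t, ww V k x‖ ^ 2 : ℝ) : ℂ)) ν := by
    simp_rw [hsq]
    exact hfi.integral_prod_left
  have hZr : Integrable (fun k => ‖∫ x in s..t, ww V k x‖ ^ 2) ν := by
    have := hZi.re
    simpa only [RCLike.re_to_complex, Complex.ofReal_re] using this
  rw [← ofReal_integral_eq_lintegral_ofReal hZr (Eventually.of_forall fun k => by positivity)]
  refine ENNReal.ofReal_le_ofReal ?_
  have e1 : ((∫ k, ‖∫ x in s..t, ww V k x‖ ^ 2 ∂ν : ℝ) : ℂ) = ∫ z, ∫ k, f k z ∂ν ∂(μ.prod μ) := by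
    rw [← integral_integral_swap hfi, ← integral_complex_ofReal]
    simp_rw [hsq]
  have e2 : ∫ k, ‖∫ x in s..t, ww V k x‖ ^ 2 ∂ν = ‖∫ z, ∫ k, f k z ∂ν ∂(μ.prod μ)‖ := by
    rw [← e1, Complex.norm_real, Real.norm_eq_abs, abs_of_nonneg (integral_nonneg fun k => by positivity)]
  rw [e2]
  have hKm : Integrable (fun z : ℝ × ℝ => C * (|V z.1| * |V z.2| * (1 / (1 + |z.1 - z.2|)))) (μ.prod μ) := by
    refine Integrable.const_mul (hVV.mono' ?_ (Eventually.of_forall fun z => ?_)) C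
    · exact Measurable.aestronglyMeasurable (by fun_prop)
    · rw [Real.norm_eq_abs, abs_of_nonneg (by positivity)]
      refine mul_le_of_le_one_right (by positivity) ?_
      rw [div_le_one (by positivity)]
      linarith [abs_nonneg (z.1 - z.2)]
  have e3 : ‖∫ z, ∫ k, f k z ∂ν ∂(μ.prod μ)‖ ≤
      ∫ z : ℝ × ℝ, C * (|V z.1| * |V z.2| * (1 / (1 + |z.1 - z.2|))) ∂(μ.prod μ) := by
    refine norm_integral_le_of_norm_le hKm (Eventually.of_forall fun z => ?_)
    simp only [hf]
    rw [integral_const_mul, norm_mul, norm_mul, Complex.norm_real, Complex.norm_real, Real.norm_eq_abs, Real.norm_eq_abs]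
    have := hC z.1 z.2
    rw [intervalIntegral.integral_of_le hαβ, ← integral_Icc_eq_integral_Ioc] at this
    have h2 := mul_le_mul_of_nonneg_left this (by positivity : 0 ≤ |V z.1| * |V z.2|)
    refine h2.trans_eq (by ring)
  refine e3.trans ?_
  rw [integral_const_mul]
  calc _ ≤ C * (η ^ (2 / p) * (1 + 2 * g)) := mul_le_mul_of_nonneg_left pb hC0
    _ = _ := by ring

lemma points (h : ℝ → ℝ) (hh : Integrable h) (hpos : ∀ x, 0 < h x) :
    ∃ (F : ℝ → ℝ) (H : ℝ) (pt : ℕ → ℕ → ℝ), (∀ s t, F t - F s = ∫ x in s..t, h x) ∧ 0 < H ∧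
      StrictMonoOn F (Ici 0) ∧ (∀ t, 0 ≤ t → F t < H) ∧ (∀ n j, 0 ≤ pt n j) ∧
      (∀ n j, j < 2 ^ n → F (pt n j) = H * j / 2 ^ n) ∧ (∀ n j, pt (n + 1) (2 * j) = pt n j) := by
  set F : ℝ → ℝ := fun x => ∫ y in (0:ℝ)..x, h y with hF
  set H := ∫ y in Ioi (0:ℝ), h y with hH
  have hsub : ∀ s t, F t - F s = ∫ x in s..t, h x := fun s t =>
    intervalIntegral.integral_interval_sub_left hh.intervalIntegrable hh.intervalIntegrable
  have hmono : StrictMono F := by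
    intro a b hab
    have := intervalIntegral.intervalIntegral_pos_of_pos (hh.intervalIntegrable (a := a) (b := b)) hpos hab
    rw [← hsub] at this
    linarith
  have hlt : ∀ t, 0 ≤ t → F t < H := by
    intro t ht
    refine (hmono (lt_add_one t)).trans_le ?_
    simp only [hF]
    rw [intervalIntegral.integral_of_le (by linarith)]
    exact setIntegral_mono_set hh.integrableOn (Eventually.of_forall fun x => (hpos x).le)
      (Eventually.of_forall fun x hx => hx.1)
  have hF0 : F 0 = 0 := by simp [hF]
  have hH0 : 0 < H := by
    have := hlt 0 le_rfl
    rwa [hF0] at this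
  have hc : Continuous F := intervalIntegral.continuous_primitive (fun a b => hh.intervalIntegrable) 0
  have htend : Tendsto F atTop (nhds H) :=
    intervalIntegral_tendsto_integral_Ioi 0 hh.integrableOn tendsto_id
  have hex : ∀ y : ℝ, ∃ x : ℝ, 0 ≤ x ∧ (0 ≤ y → y < 1 → F x = H * y) := by
    intro y
    by_cases hy : 0 ≤ y ∧ y < 1
    · have h1 : H * y < H := mul_lt_of_lt_one_right hH0 hy.2
      obtain ⟨b, hb1, hb2⟩ := ((htend.eventually (lt_mem_nhds h1)).and (eventually_ge_atTop 0)).exists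
      obtain ⟨x, hx, hx2⟩ := intermediate_value_Icc hb2 hc.continuousOn
        (show H * y ∈ Icc (F 0) (F b) from ⟨by rw [hF0]; exact mul_nonneg hH0.le hy.1, hb1.le⟩)
      exact ⟨x, hx.1, fun _ _ => hx2⟩
    · exact ⟨0, le_rfl, fun h1 h2 => absurd ⟨h1, h2⟩ hy⟩
  choose g hg0 hg using hex
  refine ⟨F, H, fun n j => g ((j:ℝ) / 2 ^ n), hsub, hH0, hmono.strictMonoOn _, hlt, fun n j => hg0 _, ?_, ?_⟩
  · intro n j hj
    rw [hg _ (by positivity), mul_div_assoc]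
    rw [div_lt_one (by positivity)]
    exact_mod_cast hj
  · intro n j
    have : ((2 * j : ℕ) : ℝ) / 2 ^ (n + 1) = (j : ℝ) / 2 ^ n := by
      push_cast
      rw [pow_succ]
      field_simp
    simp only [this]

lemma ae_summable_sqrt (ν : Measure ℝ) (S : ℕ → ℝ → ℝ) (hm : ∀ n, Measurable (S n)) (h0 : ∀ n k, 0 ≤ S n k)
    (C ρ : ℝ) (hρ0 : 0 < ρ) (hρ1 : ρ < 1)
    (hS : ∀ n, ∫⁻ k, ENNReal.ofReal (S n k) ∂ν ≤ ENNReal.ofReal (C * (ρ * ρ) ^ n)) :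
    ∀ᵐ k ∂ν, Summable fun n => √(S n k) := by
  have hgeo : Summable fun n : ℕ => ρ ^ n := summable_geometric_of_lt_one hρ0.le hρ1
  set T : ℕ → ℝ → ℝ := fun n k => S n k / ρ ^ n with hT
  have hT0 : ∀ n k, 0 ≤ T n k := fun n k => div_nonneg (h0 n k) (by positivity)
  have hTm : ∀ n, Measurable (T n) := fun n => (hm n).div_const _
  have hTi : ∀ n, ∫⁻ k, ENNReal.ofReal (T n k) ∂ν ≤ ENNReal.ofReal (C * ρ ^ n) := by
    intro n
    have e : ∀ k, ENNReal.ofReal (T n k) = ENNReal.ofReal ((ρ ^ n)⁻¹) * ENNReal.ofReal (S n k) := by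
      intro k
      rw [← ENNReal.ofReal_mul (by positivity)]
      congr 1
      simp only [hT]
      rw [div_eq_mul_inv, mul_comm]
    simp_rw [e]
    rw [lintegral_const_mul _ (hm n).ennreal_ofReal]
    calc _ ≤ ENNReal.ofReal ((ρ ^ n)⁻¹) * ENNReal.ofReal (C * (ρ * ρ) ^ n) := by gcongr; exact hS n
      _ = _ := by
        rw [← ENNReal.ofReal_mul (by positivity)]
        congr 1
        rw [mul_pow]
        field_simp
  have hfin : ∫⁻ k, ∑' n, ENNReal.ofReal (T n k) ∂ν ≠ ⊤ := by
    rw [lintegral_tsum fun n => (hTm n).ennreal_ofReal.aemeasurable]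
    refine ne_top_of_le_ne_top ?_ (ENNReal.tsum_le_tsum hTi)
    exact (hgeo.mul_left C).tsum_ofReal_ne_top
  have hae := ae_lt_top (Measurable.tsum fun n => (hTm n).ennreal_ofReal) hfin
  filter_upwards [hae] with k hk
  have hsT : Summable fun n => T n k := by
    have := ENNReal.summable_toReal hk.ne
    refine this.congr fun n => ?_
    rw [ENNReal.toReal_ofReal (hT0 n k)]
  refine Summable.of_nonneg_of_le (fun n => Real.sqrt_nonneg _) (fun n => ?_) (hgeo.add hsT)
  have hpow : 0 < ρ ^ n := by positivity
  have e : S n k = ρ ^ n * T n k := by simp only [hT]; field_simp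
  rw [e]
  refine Real.sqrt_le_iff.2 ⟨add_nonneg hpow.le (hT0 n k), ?_⟩
  nlinarith [hT0 n k, mul_nonneg hpow.le (hT0 n k)]

lemma half_line_ab (p : ℝ) (hp1 : 1 ≤ p) (hp2 : p < 2) (V : ℝ → ℝ) (hmeas : Measurable V) (hloc : LocallyIntegrable V)
    (hLp : Integrable (fun x => |V x| ^ p)) (α β : ℝ) (hα : 0 < α) (hαβ : α ≤ β) :
    ∀ᵐ k ∂(volume.restrict (Icc α β)), ∀ u : ℝ → ℂ, SchrodingerSolution V (k ^ 2) u →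
      ∃ C : ℝ, ∀ x : ℝ, 0 ≤ x → ‖u x‖ ≤ C := by
  have hp : 0 < p := by linarith
  obtain ⟨C, hC0, hC⟩ := L2 p hp1 hp2 V hmeas hloc hLp α β hα hαβ
  have hhi : Integrable (fun x : ℝ => |V x| ^ p + (1 + x ^ 2)⁻¹) := hLp.add integrable_inv_one_add_sq
  obtain ⟨F, H, pt, hFs, hH, hFm, hFH, hp0, hpF, hp2'⟩ := points (fun x => |V x| ^ p + (1 + x ^ 2)⁻¹) hhi
    (fun x => by positivity)
  set Z : ℕ → ℕ → ℝ → ℂ := fun n j k => ∫ x in (pt n j)..(pt n (j + 1)), ww V k x with hZ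
  set S : ℕ → ℝ → ℝ := fun n k => ∑ j ∈ Finset.range (2 ^ n - 1), ‖Z n j k‖ ^ 2 with hS
  have hΦc : Continuous (fun x => ∫ z in (0:ℝ)..x, V z) :=
    intervalIntegral.continuous_primitive (fun a b => li_ii hloc a b) 0
  have hΦm := hΦc.measurable
  have hwm : Measurable (Function.uncurry (ww V)) := by
    simp only [Function.uncurry_def, ww, phs]
    fun_prop
  have hZm : ∀ n j, Measurable (Z n j) := by
    intro n j
    simp only [hZ, intervalIntegral]
    exact (hwm.stronglyMeasurable.integral_prod_right.sub hwm.stronglyMeasurable.integral_prod_right).measurable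
  have hSm : ∀ n, Measurable (S n) := by
    intro n
    simp only [hS]
    exact Finset.measurable_fun_sum _ fun j _ => ((hZm n j).norm.pow_const 2)
  set r : ℝ := 2 * (1 / 2) ^ (2 / p) with hr
  have hr0 : 0 < r := by positivity
  have hr1 : r < 1 := by
    have : (1 / 2 : ℝ) ^ (2 / p) < (1 / 2 : ℝ) ^ (1:ℝ) :=
      Real.rpow_lt_rpow_of_exponent_gt (by norm_num) (by norm_num) (by rw [lt_div_iff₀ hp]; linarith)
    rw [Real.rpow_one] at this
    rw [hr]; linarith
  have hρ : √r * √r = r := Real.mul_self_sqrt hr0.le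
  have hSi : ∀ n, ∫⁻ k in Icc α β, ENNReal.ofReal (S n k) ≤ ENNReal.ofReal (C * H ^ (2 / p) * (√r * √r) ^ n) := by
    intro n
    have hη : 0 < H / 2 ^ n := by positivity
    have hterm : ∀ j ∈ Finset.range (2 ^ n - 1), ∫⁻ k in Icc α β, ENNReal.ofReal (‖Z n j k‖ ^ 2) ≤
        ENNReal.ofReal (C * (H / 2 ^ n) ^ (2 / p)) := by
      intro j hj
      rw [Finset.mem_range] at hj
      have hj1 : j + 1 < 2 ^ n := by omega
      have hj0 : j < 2 ^ n := by omega
      have e0 := hpF n j hj0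
      have e1 := hpF n (j + 1) hj1
      have hd : F (pt n (j + 1)) - F (pt n j) = H / 2 ^ n := by
        rw [e0, e1]; push_cast; ring
      have hle : pt n j ≤ pt n (j + 1) := by
        refine (hFm.le_iff_le (hp0 _ _) (hp0 _ _)).1 ?_
        linarith
      refine hC _ _ _ hle hη ?_
      rw [← hd, hFs]
      refine intervalIntegral.integral_mono_on hle hLp.intervalIntegrable hhi.intervalIntegrable fun x _ => ?_
      have : 0 ≤ (1 + x ^ 2)⁻¹ := by positivity
      linarith
    have e : ∀ k, ENNReal.ofReal (S n k) = ∑ j ∈ Finset.range (2 ^ n - 1), ENNReal.ofReal (‖Z n j k‖ ^ 2) := by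
      intro k
      simp only [hS]
      exact ENNReal.ofReal_sum_of_nonneg fun j _ => by positivity
    simp_rw [e]
    rw [lintegral_finset_sum _ fun j _ => ((hZm n j).norm.pow_const 2).ennreal_ofReal]
    refine (Finset.sum_le_sum hterm).trans ?_
    rw [Finset.sum_const, Finset.card_range, nsmul_eq_mul, ← ENNReal.ofReal_natCast,
      ← ENNReal.ofReal_mul (by positivity)]
    refine ENNReal.ofReal_le_ofReal ?_
    have hc : ((2 ^ n - 1 : ℕ) : ℝ) ≤ 2 ^ n := by
      have : (2 ^ n - 1 : ℕ) ≤ 2 ^ n := Nat.sub_le _ _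
      exact_mod_cast this
    have e2 : (H / 2 ^ n) ^ (2 / p) = H ^ (2 / p) * ((1 / 2 : ℝ) ^ (2 / p)) ^ n := by
      rw [div_eq_mul_one_div, ← one_div_pow, Real.mul_rpow hH.le (by positivity), ← Real.rpow_natCast,
        ← Real.rpow_natCast, ← Real.rpow_mul (by positivity), ← Real.rpow_mul (by positivity), mul_comm (n:ℝ)]
    calc ((2 ^ n - 1 : ℕ) : ℝ) * (C * (H / 2 ^ n) ^ (2 / p)) ≤ 2 ^ n * (C * (H / 2 ^ n) ^ (2 / p)) := by gcongr
      _ = _ := by rw [e2, hρ, hr, mul_pow]; ring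
  have hae := ae_summable_sqrt (volume.restrict (Icc α β)) S hSm (fun n k => Finset.sum_nonneg fun j _ => by positivity)
    (C * H ^ (2 / p)) (√r) (Real.sqrt_pos.2 hr0) (by
      rw [Real.sqrt_lt' one_pos]; simpa using hr1) hSi
  filter_upwards [hae, ae_restrict_mem measurableSet_Icc] with k hk hkm u hu
  have hk0 : 0 < k := hα.trans_le hkm.1
  obtain ⟨A, B, hA, hB, eA, eB, hub⟩ := ode V hloc k hk0 u hu
  set w : ℝ → ℂ := fun x => (Complex.I / (2 * k)) * ww V k x with hw
  have hstar : ∀ x, star (w x) = (-(Complex.I / (2 * k))) * star (ww V k x) := by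
    intro x
    simp only [hw]
    rw [star_mul']
    congr 1
    simp [Complex.star_def, neg_div]
  have hcn : ‖(Complex.I / (2 * k) : ℂ)‖ = 1 / (2 * k) := by
    rw [norm_div, Complex.norm_I, norm_mul, Complex.norm_real, Real.norm_eq_abs, abs_of_pos hk0]
    simp
  have hwn : ∀ x, ‖w x‖ = 1 / (2 * k) * |V x| := by
    intro x
    simp only [hw]
    rw [norm_mul, ww_norm, hcn]
  have hwm' : Measurable w := by
    have : Measurable (ww V k) := hwm.comp measurable_prodMk_left
    exact this.const_mul _
  have hwl : LocallyIntegrable w := by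
    have hV' : LocallyIntegrable (fun x => (1 / (2 * k)) * V x) := hloc.smul (1 / (2 * k))
    refine hV'.mono hwm'.aestronglyMeasurable (Eventually.of_forall fun x => ?_)
    rw [hwn, Real.norm_eq_abs, abs_mul, abs_of_pos (by positivity : 0 < 1 / (2 * k))]
  obtain ⟨K, hK⟩ := bounded_fixed A B w hA hB hwl
    (fun s t => by rw [eA]) (fun s t => by rw [eB]; simp_rw [hstar]) F H hH hFm hFH pt hp0 hpF hp2'
    (by
      intro t ht
      refine ⟨(1 + t ^ 2) / (2 * k), by positivity, fun a b ha hab hbt => ?_⟩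
      rw [hFs, ← intervalIntegral.integral_const_mul]
      refine intervalIntegral.integral_mono_on hab (li_ii hwl a b).norm
        ((hhi.intervalIntegrable).const_mul _) fun x hx => ?_
      rw [hwn]
      have h1 := abs_le_split p 1 (V x) hp1 one_pos
      rw [Real.one_rpow, one_mul] at h1
      have hx0 : 0 ≤ x := ha.trans hx.1
      have hxt : x ≤ t := hx.2.trans hbt
      have h2 : 1 ≤ (1 + t ^ 2) * (1 + x ^ 2)⁻¹ := by
        rw [← div_eq_mul_inv, le_div_iff₀ (by positivity)]
        nlinarith
      have h3 : |V x| ^ p ≤ (1 + t ^ 2) * |V x| ^ p := by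
        have : 0 ≤ |V x| ^ p := by positivity
        nlinarith [sq_nonneg t]
      have h4 : |V x| ≤ (1 + t ^ 2) * (|V x| ^ p + (1 + x ^ 2)⁻¹) := by
        rw [mul_add]; linarith
      calc 1 / (2 * k) * |V x| ≤ 1 / (2 * k) * ((1 + t ^ 2) * (|V x| ^ p + (1 + x ^ 2)⁻¹)) := by gcongr
        _ = _ := by ring)
    (fun n => 1 / (2 * k) * √(S n k)) (fun n => by positivity) (hk.mul_left _) (by
      intro n
      rw [mul_pow, Real.sq_sqrt (Finset.sum_nonneg fun j _ => by positivity)]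
      rw [Finset.mul_sum]
      refine Finset.sum_le_sum fun j _ => le_of_eq ?_
      simp only [hw, hZ]
      rw [intervalIntegral.integral_const_mul, norm_mul, hcn, mul_pow])
  refine ⟨K / (2 * k), fun x hx => (hub x).trans ?_⟩
  exact div_le_div_of_nonneg_right (hK x hx) (by positivity)

lemma half_line (p : ℝ) (hp1 : 1 ≤ p) (hp2 : p < 2) (V : ℝ → ℝ) (hmeas : Measurable V) (hloc : LocallyIntegrable V)
    (hLp : Integrable (fun x => |V x| ^ p)) :
    ∀ᵐ k ∂(volume.restrict (Ioi (0:ℝ))), ∀ u : ℝ → ℂ, SchrodingerSolution V (k ^ 2) u →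
      ∃ C : ℝ, ∀ x : ℝ, 0 ≤ x → ‖u x‖ ≤ C := by
  have h : ∀ m : ℕ, ∀ᵐ k ∂(volume.restrict (Icc (1 / ((m:ℝ) + 1)) ((m:ℝ) + 1))), ∀ u : ℝ → ℂ,
      SchrodingerSolution V (k ^ 2) u → ∃ C : ℝ, ∀ x : ℝ, 0 ≤ x → ‖u x‖ ≤ C := by
    intro m
    refine half_line_ab p hp1 hp2 V hmeas hloc hLp _ _ (by positivity) ?_
    have : (0:ℝ) ≤ m := by positivity
    rw [div_le_iff₀ (by positivity)]
    nlinarith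
  have h2 := (ae_restrict_iUnion_iff (μ := volume) (fun m : ℕ => Icc (1 / ((m:ℝ) + 1)) ((m:ℝ) + 1)) _).2 h
  refine ae_restrict_of_ae_restrict_of_subset ?_ h2
  intro k hk
  have hk : 0 < k := hk
  obtain ⟨m, hm⟩ := exists_nat_ge (max k (1 / k))
  refine mem_iUnion.2 ⟨m, ?_, ?_⟩
  · have h1 : 1 / k ≤ m := (le_max_right _ _).trans hm
    rw [div_le_iff₀ hk] at h1
    rw [div_le_iff₀ (by positivity)]
    nlinarith
  · have h1 : k ≤ m := (le_max_left _ _).trans hm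
    linarith

lemma reflect (V : ℝ → ℝ) (E : ℝ) (u : ℝ → ℂ) (hu : SchrodingerSolution V E u) :
    SchrodingerSolution (fun x => V (-x)) E (fun x => u (-x)) := by
  obtain ⟨hd, he⟩ := hu
  refine ⟨hd.comp differentiable_neg, fun x => ?_⟩
  have e : ∀ x, deriv (fun x => u (-x)) x = - deriv u (-x) := fun x => deriv_comp_neg u x
  rw [e, e, he (-x), neg_zero]
  have : ∫ y in (0:ℝ)..x, ((V (-y) : ℂ) - (E : ℂ)) * u (-y) = ∫ y in (-x)..(-0), ((V y : ℂ) - (E : ℂ)) * u y :=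
    intervalIntegral.integral_comp_neg (fun y => ((V y : ℂ) - (E : ℂ)) * u y)
  rw [this, neg_zero, intervalIntegral.integral_symm]
  ring

theorem ae_bounded_solutions
    (p : ℝ) (hp1 : 1 ≤ p) (hp2 : p < 2)
    (V : ℝ → ℝ) (hmeas : Measurable V)
    (hloc : LocallyIntegrable V)
    (hLp : Integrable (fun x => |V x| ^ p)) :
    ∀ᵐ k ∂(volume.restrict (Ioi (0 : ℝ))),
      ∀ u : ℝ → ℂ, SchrodingerSolution V (k ^ 2) u →
        ∃ C : ℝ, ∀ x : ℝ, ‖u x‖ ≤ C := by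
  have hm' : Measurable (fun x => V (-x)) := hmeas.comp measurable_neg
  have hLp' : Integrable (fun x => |V (-x)| ^ p) := hLp.comp_neg
  have hloc' : LocallyIntegrable (fun x => V (-x)) := by
    rw [locallyIntegrable_iff]
    intro K hK
    obtain ⟨R, hR⟩ := hK.isBounded.subset_closedBall 0
    rw [Real.closedBall_eq_Icc] at hR
    refine IntegrableOn.mono_set ?_ hR
    have h1 : IntervalIntegrable (fun x => V (-x)) volume (0 - R) (0 + R) := by
      have := (IntervalIntegrable.iff_comp_neg (f := V) (a := -(0 - R)) (b := -(0 + R))).1 (li_ii hloc _ _)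
      simpa using this
    by_cases hR0 : (0:ℝ) - R ≤ 0 + R
    · exact (intervalIntegrable_iff_integrableOn_Icc_of_le hR0).1 h1
    · rw [Icc_eq_empty hR0]; exact integrableOn_empty
  filter_upwards [half_line p hp1 hp2 V hmeas hloc hLp, half_line p hp1 hp2 _ hm' hloc' hLp'] with k h1 h2 u hu
  obtain ⟨C1, hC1⟩ := h1 u hu
  obtain ⟨C2, hC2⟩ := h2 _ (reflect V _ u hu)
  refine ⟨max C1 C2, fun x => ?_⟩
  rcases le_total 0 x with hx | hx
  · exact (hC1 x hx).trans (le_max_left _ _)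
  · have := hC2 (-x) (by linarith)
    simp only [neg_neg] at this
    exact this.trans (le_max_right _ _)
end

section
/- Let V : ℝ → ℝ be continuous with compact support contained in [0, L], let k ∈ ℝ, k ≠ 0, and let f : ℝ → ℂ be the Jost solution, i.e. the twice continuously differentiable solution of −f'' + V f = k²f with f(x) = exp(ikx) for all x ≥ L. Then there exist unique complex numbers a(k) and b(k) such that f(x) = a(k)·exp(ikx) + b(k)·exp(−ikx) for all x ≤ 0, and they satisfy |a(k)|² = 1 + |b(k)|². -/
open Real Set MeasureTheory

lemma jost_exp_deriv (c : ℂ) (x : ℝ) :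
    HasDerivAt (fun x : ℝ => Complex.exp (c * x)) (c * Complex.exp (c * x)) x := by
  have h1 : HasDerivAt (fun x : ℝ => c * (x : ℂ)) (c * 1) x :=
    (Complex.ofRealCLM.hasDerivAt (x := x)).const_mul c
  have := h1.cexp
  convert this using 1
  ring

/-- **Scattering coefficients of the Jost solution.** For `V` continuous with support
in `[0,L]`, `k ≠ 0`, and `f` the Jost solution (`-f'' + V f = k² f`, `f(x) = e^{ikx}`
for `x ≥ L`), there are unique `a, b ∈ ℂ` with `f(x) = a e^{ikx} + b e^{-ikx}` for all
`x ≤ 0`, and they satisfy `|a|² = 1 + |b|²`. -/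
theorem jost_scattering_coefficients
    (V : ℝ → ℝ) (L k : ℝ) (hVc : Continuous V)
    (hsupp : Function.support V ⊆ Icc 0 L) (hk : k ≠ 0)
    (f : ℝ → ℂ) (hf : ContDiff ℝ 2 f)
    (hode : ∀ x : ℝ, -(deriv (deriv f) x) + (V x : ℂ) * f x = ((k : ℂ) ^ 2) * f x)
    (hfree : ∀ x ≥ L, f x = Complex.exp (Complex.I * k * x)) :
    (∃! ab : ℂ × ℂ, ∀ x ≤ (0 : ℝ),
        f x = ab.1 * Complex.exp (Complex.I * k * x) +
          ab.2 * Complex.exp (-(Complex.I * k * x))) ∧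
    (∀ a b : ℂ,
      (∀ x ≤ (0 : ℝ),
        f x = a * Complex.exp (Complex.I * k * x) +
          b * Complex.exp (-(Complex.I * k * x))) →
      ‖a‖ ^ 2 = 1 + ‖b‖ ^ 2) := by
  have hkc : (k : ℂ) ≠ 0 := by exact_mod_cast hk
  have hI := Complex.I_ne_zero
  have hI2 := Complex.I_sq
  have hd0 : ∀ x, HasDerivAt f (deriv f x) x := fun x =>
    (hf.differentiable (by norm_num) x).hasDerivAt
  have hf1 : ContDiff ℝ 1 (deriv f) := by
    have : ContDiff ℝ (1 + 1) f := by simpa [one_add_one_eq_two] using hf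
    exact (contDiff_succ_iff_deriv.1 this).2.2
  have hd1 : ∀ x, HasDerivAt (deriv f) (((V x : ℂ) - (k : ℂ) ^ 2) * f x) x := by
    intro x
    have h := (hf1.differentiable (by norm_num) x).hasDerivAt
    have e : deriv (deriv f) x = ((V x : ℂ) - (k : ℂ) ^ 2) * f x := by
      linear_combination - hode x
    rwa [e] at h
  have hV : ∀ x ≤ (0 : ℝ), V x = 0 := by
    have hc : IsClosed {x | V x = 0} := isClosed_eq hVc continuous_const
    have hs : Iio (0 : ℝ) ⊆ {x | V x = 0} := by
      intro x hx
      by_contra hne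
      exact absurd (hsupp hne).1 (not_le.2 hx)
    have := closure_minimal hs hc
    rw [closure_Iio] at this
    exact fun x hx => this hx
  have hE : ∀ x : ℝ, HasDerivAt (fun x : ℝ => Complex.exp (Complex.I * k * x))
      (Complex.I * k * Complex.exp (Complex.I * k * x)) x := fun x => jost_exp_deriv _ x
  have hE' : ∀ x : ℝ, HasDerivAt (fun x : ℝ => Complex.exp (-(Complex.I * k * x)))
      (-(Complex.I * k) * Complex.exp (-(Complex.I * k * x))) x := fun x => by
    have := jost_exp_deriv (-(Complex.I * k)) x
    simpa only [neg_mul] using this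
  have hEE : ∀ x : ℝ, Complex.exp (Complex.I * k * x) * Complex.exp (-(Complex.I * k * x)) = 1 :=
    fun x => by rw [← Complex.exp_add, add_neg_cancel, Complex.exp_zero]
  -- derivative from a representation to the left
  have hrep : ∀ a b : ℂ, (∀ x ≤ (0 : ℝ), f x = a * Complex.exp (Complex.I * k * x) +
          b * Complex.exp (-(Complex.I * k * x))) →
      deriv f (-1) = Complex.I * k * (a * Complex.exp (Complex.I * k * (-1 : ℝ)) -
          b * Complex.exp (-(Complex.I * k * (-1 : ℝ)))) := by
    intro a b h
    have h1 := ((hE (-1)).const_mul a).add ((hE' (-1)).const_mul b)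
    have h2 : f =ᶠ[nhds (-1)] ((fun x : ℝ => a * Complex.exp (Complex.I * k * x)) +
        fun x : ℝ => b * Complex.exp (-(Complex.I * k * x))) := by
      filter_upwards [Iio_mem_nhds (show (-1 : ℝ) < 0 by norm_num)] with x hx
      exact h x (le_of_lt hx)
    rw [(h1.congr_of_eventuallyEq h2).deriv]
    ring
  have hfreed : deriv f (L + 1) = Complex.I * k * Complex.exp (Complex.I * k * (L + 1 : ℝ)) := by
    have h2 : f =ᶠ[nhds (L + 1)] (fun x : ℝ => Complex.exp (Complex.I * k * x)) := by
      filter_upwards [Ioi_mem_nhds (show L < L + 1 by linarith)] with x hx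
      exact hfree x (le_of_lt hx)
    exact ((hE (L + 1)).congr_of_eventuallyEq h2).deriv
  -- the coefficient functions
  have hA : ∀ x : ℝ, HasDerivAt
      (fun x : ℝ => (deriv f x + Complex.I * k * f x) * Complex.exp (-(Complex.I * k * x)))
      (V x * f x * Complex.exp (-(Complex.I * k * x))) x := by
    intro x
    have := ((hd1 x).add ((hd0 x).const_mul (Complex.I * k))).mul (hE' x)
    refine this.congr_deriv ?_
    simp only [Pi.add_apply]
    linear_combination (-(k : ℂ) ^ 2 * f x * Complex.exp (-(Complex.I * k * x))) * hI2
  have hB : ∀ x : ℝ, HasDerivAt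
      (fun x : ℝ => (deriv f x - Complex.I * k * f x) * Complex.exp (Complex.I * k * x))
      (V x * f x * Complex.exp (Complex.I * k * x)) x := by
    intro x
    have := ((hd1 x).sub ((hd0 x).const_mul (Complex.I * k))).mul (hE x)
    refine this.congr_deriv ?_
    simp only [Pi.sub_apply]
    linear_combination (-(k : ℂ) ^ 2 * f x * Complex.exp (Complex.I * k * x)) * hI2
  have hconst : ∀ (g g' : ℝ → ℂ), (∀ x, HasDerivAt g (g' x) x) → (∀ x ≤ 0, g' x = 0) →
      ∀ x ≤ 0, g x = g 0 := by
    intro g g' h h0 x hx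
    refine (constant_of_has_deriv_right_zero (a := x) (b := 0)
      (fun y _ => (h y).continuousAt.continuousWithinAt) ?_ 0 ⟨hx, le_rfl⟩).symm
    intro y hy
    have := (h y).hasDerivWithinAt (s := Ici y)
    rwa [h0 y hy.2.le] at this
  have hA0 := hconst _ _ hA (fun x hx => by simp [hV x hx])
  have hB0 := hconst _ _ hB (fun x hx => by simp [hV x hx])
  refine ⟨⟨((deriv f 0 + Complex.I * k * f 0) / (2 * Complex.I * k),
    -(deriv f 0 - Complex.I * k * f 0) / (2 * Complex.I * k)), ?_, ?_⟩, ?_⟩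
  · intro x hx
    have h1 := hA0 x hx
    have h2 := hB0 x hx
    simp only [Complex.ofReal_zero, mul_zero, neg_zero, Complex.exp_zero, mul_one] at h1 h2
    dsimp only
    rw [← h1, ← h2]
    field_simp
    linear_combination (-2 * Complex.I * k * f x) * hEE x
  · rintro ⟨a, b⟩ h
    dsimp only at h
    have h1 := hA0 (-1) (by norm_num)
    have h2 := hB0 (-1) (by norm_num)
    have h3 := h (-1) (by norm_num)
    have h4 := hrep a b h
    have h5 := hEE (-1)
    simp only [Complex.ofReal_zero, mul_zero, neg_zero, Complex.exp_zero, mul_one] at h1 h2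
    rw [← h1, ← h2, h3, h4]
    generalize Complex.exp (Complex.I * k * (-1 : ℝ)) = e at *
    generalize Complex.exp (-(Complex.I * k * (-1 : ℝ))) = e' at *
    ext1
    · dsimp only
      rw [eq_div_iff (by simp [hkc])]
      linear_combination (-2 * Complex.I * k * a) * h5
    · dsimp only
      rw [eq_div_iff (by simp [hkc])]
      linear_combination (-2 * Complex.I * k * b) * h5
  · intro a b h
    have hW : ∀ x : ℝ, HasDerivAt (fun x => star (f x) * deriv f x - f x * star (deriv f x)) 0 x := by
      intro x
      have := ((hd0 x).star.mul (hd1 x)).sub ((hd0 x).mul (hd1 x).star)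
      refine this.congr_deriv ?_
      simp
      ring
    have hc := is_const_of_deriv_eq_zero (fun x => (hW x).differentiableAt)
      (fun x => (hW x).deriv) (-1) (L + 1)
    have hst : ∀ x : ℝ, star (Complex.exp (Complex.I * k * x)) = Complex.exp (-(Complex.I * k * x)) := by
      intro x
      change (starRingEnd ℂ) _ = _
      rw [← Complex.exp_conj]
      simp
    have hst' : ∀ x : ℝ, star (Complex.exp (-(Complex.I * k * x))) = Complex.exp (Complex.I * k * x) := by
      intro x
      rw [← hst, star_star]
    have hsI : star Complex.I = -Complex.I := Complex.conj_I
    have hsk : star (k : ℂ) = k := Complex.conj_ofReal k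
    rw [hfreed, hfree (L + 1) (by linarith), hrep a b h, h (-1) (by norm_num)] at hc
    simp only [star_add, star_sub, star_mul, hst, hst', hsI, hsk] at hc
    have h5 := hEE (-1)
    have h6 := hEE (L + 1)
    generalize Complex.exp (Complex.I * k * (-1 : ℝ)) = e at *
    generalize Complex.exp (-(Complex.I * k * (-1 : ℝ))) = e' at *
    have key : (2 * Complex.I * k) * (a * star a - (1 + b * star b)) = 0 := by
      linear_combination hc - (2 * Complex.I * k) * (a * star a - b * star b) * h5 +
        (2 * Complex.I * k) * h6
    have key2 : a * star a = 1 + b * star b := by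
      rcases mul_eq_zero.1 key with h7 | h7
      · simp [hkc] at h7
      · linear_combination h7
    have ha : a * star a = ((‖a‖ ^ 2 : ℝ) : ℂ) := by
      push_cast; exact Complex.mul_conj' a
    have hb : b * star b = ((‖b‖ ^ 2 : ℝ) : ℂ) := by
      push_cast; exact Complex.mul_conj' b
    rw [ha, hb] at key2
    exact_mod_cast key2
end
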